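/- Let r ≥ 2, let F be an r-graph, let k be an integer satisfying the Ramsey condition for F, and let w : ℤ₊ → ℤ₊ be a weight function with w(m)/m^r → 0 as m → ∞. For every ε > 0 there exists N such that for every n ≥ N and every Berge-F-free hypergraph H on n vertices in which every hyperedge has size at least k, we have ∑_{h ∈ E(H)} w(|h|) ≤ ε · n^r. -/

import Mathlib

open Finset

/-- `H` contains (a subhypergraph which is) a Berge copy of `F`. -/
def ContainsBerge {α β : Type*} [DecidableEq α] [DecidableEq β]
    (F : Finset (Finset α)) (H : Finset (Finset β)) : Prop :=
  ∃ (φ : α → β) (f : Finset α → Finset β),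
    Function.Injective φ ∧ Set.InjOn f (F : Set (Finset α)) ∧
    (∀ e ∈ F, f e ∈ H) ∧ (∀ e ∈ F, e.image φ ⊆ f e)

/-- `G` contains a subhypergraph isomorphic to `F`. -/
def CopyIn {α β : Type*} [DecidableEq α] [DecidableEq β]
    (F : Finset (Finset α)) (G : Finset (Finset β)) : Prop :=
  ∃ φ : α → β, Function.Injective φ ∧ ∀ e ∈ F, e.image φ ∈ G

noncomputable def exBerge {α : Type*} [DecidableEq α] (r n : ℕ) (F : Finset (Finset α)) : ℕ :=
  sSup {m | ∃ H : Finset (Finset (Fin n)),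
    (∀ e ∈ H, e.card = r) ∧ ¬ ContainsBerge F H ∧ H.card = m}

noncomputable def exForb {α : Type*} [DecidableEq α] (r n : ℕ) (F : Finset (Finset α)) : ℕ :=
  sSup {m | ∃ H : Finset (Finset (Fin n)),
    (∀ e ∈ H, e.card = r) ∧ ¬ CopyIn F H ∧ H.card = m}

/-- number of `r`-sets of vertices all of whose `k`-subsets are edges of `G`,
i.e. the number of copies of the complete `k`-graph on `r` vertices in `G`. -/
def cliqueCount (k r : ℕ) {n : ℕ} (G : Finset (Finset (Fin n))) : ℕ :=
  (((Finset.univ : Finset (Fin n)).powersetCard r).filter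
    (fun S => ∀ e ∈ S.powersetCard k, e ∈ G)).card

noncomputable def exGenClique {α : Type*} [DecidableEq α] (k r n : ℕ)
    (F : Finset (Finset α)) : ℕ :=
  sSup {m | ∃ G : Finset (Finset (Fin n)),
    (∀ e ∈ G, e.card = k) ∧ ¬ CopyIn F G ∧ cliqueCount k r G = m}

/-- `k ≥ R^(r)(F,F)`: every 2-coloring of the `r`-subsets of a `k`-set has a
monochromatic copy of `F`. -/
def RamseyProp {α : Type*} [DecidableEq α] (k r : ℕ) (F : Finset (Finset α)) : Prop :=
  ∀ χ : Finset (Fin k) → Bool, ∃ c : Bool,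
    CopyIn F (((Finset.univ : Finset (Fin k)).powersetCard r).filter (fun e => χ e = c))

def rShadow {β : Type*} [DecidableEq β] (r : ℕ) (H : Finset (Finset β)) : Finset (Finset β) :=
  H.biUnion (fun h => h.powersetCard r)

/-- the `k`-uniform expansion of a graph: add `k-2` new distinct vertices to each edge. -/
def expansion {α : Type*} [DecidableEq α] (k : ℕ) (F0 : Finset (Finset α)) :
    Finset (Finset (α ⊕ Finset α × Fin (k - 2))) :=
  F0.image (fun e =>
    e.image Sum.inl ∪ (Finset.univ : Finset (Fin (k - 2))).image (fun i => Sum.inr (e, i)))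

/-- Turán hypergraph `T^r(n,q)`: partition `Fin n` into `q` parts (residues mod `q`),
edges are the `r`-sets meeting every part at most once. -/
def turanEdges (r n q : ℕ) : Finset (Finset (Fin n)) :=
  ((Finset.univ : Finset (Fin n)).powersetCard r).filter
    (fun S => ∀ u ∈ S, ∀ v ∈ S, (u : ℕ) % q = (v : ℕ) % q → u = v)

def Colorable2 {α : Type*} (F0 : Finset (Finset α)) (t : ℕ) : Prop :=
  ∃ c : α → Fin t, ∀ e ∈ F0, ∀ u ∈ e, ∀ v ∈ e, u ≠ v → c u ≠ c v

/-- number of subhypergraphs of `G` isomorphic to `F`. -/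
def copyCount {α β : Type*} [Fintype α] [DecidableEq α] [Fintype β] [DecidableEq β]
    (F : Finset (Finset α)) (G : Finset (Finset β)) : ℕ :=
  (G.powerset.filter (fun G' => ∃ φ : α → β, Function.Injective φ ∧
      G' = F.image (fun e => e.image φ))).card

section Loeb

open MeasureTheory Filter Topology
open scoped ENNReal

variable {X : ℕ → Type*}

/-- The subset of `∀ k, X k` cut out by a sequence of sets along an ultrafilter. -/
def internalSet (u : Ultrafilter ℕ) (A : ∀ k, Set (X k)) : Set (∀ k, X k) :=
  {x | ∀ᶠ k in (u : Filter ℕ), x k ∈ A k}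

variable {u : Ultrafilter ℕ}

lemma mem_internalSet {A : ∀ k, Set (X k)} {x : ∀ k, X k} :
    x ∈ internalSet u A ↔ ∀ᶠ k in (u : Filter ℕ), x k ∈ A k := Iff.rfl

lemma internalSet_compl (A : ∀ k, Set (X k)) :
    (internalSet u A)ᶜ = internalSet u (fun k => (A k)ᶜ) := by
  ext x
  exact Ultrafilter.eventually_not.symm

lemma internalSet_union (A B : ∀ k, Set (X k)) :
    internalSet u A ∪ internalSet u B = internalSet u (fun k => A k ∪ B k) := by
  ext x
  simp [mem_internalSet, Ultrafilter.eventually_or]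

lemma internalSet_inter (A B : ∀ k, Set (X k)) :
    internalSet u A ∩ internalSet u B = internalSet u (fun k => A k ∩ B k) := by
  ext x
  simp [mem_internalSet, eventually_and]

lemma internalSet_sdiff (A B : ∀ k, Set (X k)) :
    internalSet u A \ internalSet u B = internalSet u (fun k => A k \ B k) := by
  simp only [Set.sdiff_eq, internalSet_compl, internalSet_inter]

lemma internalSet_empty : internalSet u (fun k => (∅ : Set (X k))) = ∅ := by
  ext x
  simp [mem_internalSet, NeBot.ne]

lemma internalSet_univ : internalSet u (fun k => (Set.univ : Set (X k))) = Set.univ := by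
  ext x
  simp [mem_internalSet]

lemma internalSet_biInter {ι : Type*} (s : Finset ι) (A : ι → ∀ k, Set (X k)) :
    internalSet u (fun k => ⋂ i ∈ s, A i k) = ⋂ i ∈ s, internalSet u (A i) := by
  ext x
  simp only [mem_internalSet, Set.mem_iInter]
  exact Filter.eventually_all_finset s

lemma internalSet_biUnion {ι : Type*} (s : Finset ι) (A : ι → ∀ k, Set (X k)) :
    internalSet u (fun k => ⋃ i ∈ s, A i k) = ⋃ i ∈ s, internalSet u (A i) := by
  apply compl_injective
  simp only [internalSet_compl, Set.compl_iUnion, internalSet_biInter]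

lemma eventually_subset_of_internalSet_subset [∀ k, Nonempty (X k)] {A B : ∀ k, Set (X k)}
    (h : internalSet u A ⊆ internalSet u B) : ∀ᶠ k in (u : Filter ℕ), A k ⊆ B k := by
  classical
  by_contra hcon
  rw [← Ultrafilter.eventually_not] at hcon
  have hx : ∀ k, ∃ x : X k, ¬ A k ⊆ B k → x ∈ A k ∧ x ∉ B k := by
    intro k
    by_cases hk : A k ⊆ B k
    · exact ⟨Classical.arbitrary _, fun h => absurd hk h⟩
    · obtain ⟨x, hx⟩ := Set.not_subset.1 hk
      exact ⟨x, fun _ => hx⟩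
  choose x hx using hx
  have hB : x ∈ internalSet u B := h (hcon.mono fun k hk => (hx k hk).1)
  obtain ⟨k, hk⟩ := (hcon.and hB).exists
  exact (hx k hk.1).2 hk.2

/-- Countable saturation: a countable cover of an internal set by internal sets has a finite
subcover. -/
lemma internalSet_exists_finite_subcover [∀ k, Nonempty (X k)] (hu : (u : Filter ℕ) ≤ atTop)
    {A : ∀ k, Set (X k)} {B : ℕ → ∀ k, Set (X k)}
    (h : internalSet u A ⊆ ⋃ i, internalSet u (B i)) :
    ∃ N, internalSet u A ⊆ ⋃ i ∈ Finset.range N, internalSet u (B i) := by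
  classical
  by_contra! hcon
  let D : ℕ → ∀ k, Set (X k) := fun N k => A k \ ⋃ i ∈ Finset.range N, B i k
  have hD : ∀ N, ∀ᶠ k in (u : Filter ℕ), (D N k).Nonempty := by
    intro N
    by_contra hN
    rw [← Ultrafilter.eventually_not] at hN
    apply hcon N
    rw [← internalSet_biUnion]
    intro x hx
    filter_upwards [hN, hx] with k hk hxk
    rw [Set.not_nonempty_iff_eq_empty, Set.sdiff_eq_empty] at hk
    exact hk hxk
  have hanti : ∀ k, Antitone fun N => D N k := by
    intro k M N hMN
    apply Set.sdiff_subset_sdiff_right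
    exact Set.biUnion_subset_biUnion_left fun i hi =>
      Finset.mem_coe.2 (Finset.range_mono hMN hi)
  let n : ℕ → ℕ := fun k => Nat.findGreatest (fun N => (D N k).Nonempty) k
  have hx : ∀ k, ∃ x : X k, (D (n k) k).Nonempty → x ∈ D (n k) k := by
    intro k
    by_cases hk : (D (n k) k).Nonempty
    · exact ⟨hk.some, fun _ => hk.some_mem⟩
    · exact ⟨Classical.arbitrary _, fun h => absurd h hk⟩
  choose x hx using hx
  have hxD : ∀ N, ∀ᶠ k in (u : Filter ℕ), x k ∈ D N k := by
    intro N
    filter_upwards [hD N, hu (eventually_ge_atTop N)] with k hk hNk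
    have h1 : N ≤ n k := Nat.le_findGreatest hNk hk
    have h2 : (D (n k) k).Nonempty :=
      Nat.findGreatest_spec (P := fun N => (D N k).Nonempty) hNk hk
    exact hanti k h1 (hx k h2)
  have hxA : x ∈ internalSet u A := (hxD 0).mono fun k hk => hk.1
  obtain ⟨i, hi⟩ := Set.mem_iUnion.1 (h hxA)
  obtain ⟨k, hk1, hk2⟩ := ((hxD (i + 1)).and hi).exists
  exact hk1.2 (Set.mem_biUnion (Finset.mem_coe.2 (Finset.self_mem_range_succ i)) hk2)

lemma isSetRing_range_internalSet (u : Ultrafilter ℕ) :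
    IsSetRing (Set.range (internalSet (X := X) u)) where
  empty_mem := ⟨_, internalSet_empty⟩
  union_mem := by
    rintro _ _ ⟨A, rfl⟩ ⟨B, rfl⟩
    exact ⟨_, (internalSet_union A B).symm⟩
  sdiff_mem := by
    rintro _ _ ⟨A, rfl⟩ ⟨B, rfl⟩
    exact ⟨_, (internalSet_sdiff A B).symm⟩

/-- Existence of the Loeb measure associated with a sequence of measures. -/
theorem exists_loeb_measure [∀ k, Nonempty (X k)] [∀ k, MeasurableSpace (X k)]
    [∀ k, DiscreteMeasurableSpace (X k)] [m : MeasurableSpace (∀ k, X k)]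
    (hu : (u : Filter ℕ) ≤ atTop)
    (hm : m = MeasurableSpace.generateFrom (Set.range (internalSet (X := X) u)))
    (P : ∀ k, Measure (X k)) :
    ∃ μ : Measure (∀ k, X k), ∀ A : ∀ k, Set (X k),
      Tendsto (fun k => P k (A k)) u (𝓝 (μ (internalSet u A))) := by
  classical
  let L : (∀ k, Set (X k)) → ℝ≥0∞ := fun A => (u.map fun k => P k (A k)).lim
  have hL : ∀ A, Tendsto (fun k => P k (A k)) u (𝓝 (L A)) := fun A =>
    Ultrafilter.le_nhds_lim (u.map fun k => P k (A k))
  have hcongr : ∀ A B, internalSet u A = internalSet u B → L A = L B := by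
    intro A B h
    refine tendsto_nhds_unique (hL A) ((hL B).congr' ?_)
    filter_upwards [eventually_subset_of_internalSet_subset h.subset,
      eventually_subset_of_internalSet_subset h.symm.subset] with k h1 h2
    rw [h1.antisymm h2]
  let c : Set (∀ k, X k) → ℝ≥0∞ := fun s =>
    if h : ∃ A, internalSet u A = s then L h.choose else 0
  have hc : ∀ A, c (internalSet u A) = L A := by
    intro A
    have h : ∃ B, internalSet u B = internalSet u A := ⟨A, rfl⟩
    simp only [c, dif_pos h]
    exact hcongr _ _ h.choose_spec
  have hR := isSetRing_range_internalSet (X := X) u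
  let C : AddContent ℝ≥0∞ (Set.range (internalSet (X := X) u)) :=
    hR.addContent_of_union c (by
      rw [← internalSet_empty, hc]
      exact tendsto_nhds_unique (hL _) (by simp)) (by
      rintro _ _ ⟨A, rfl⟩ ⟨B, rfl⟩ hd
      rw [internalSet_union, hc, hc, hc]
      refine tendsto_nhds_unique (hL _) (((hL A).add (hL B)).congr' ?_)
      rw [Set.disjoint_iff_inter_eq_empty, internalSet_inter, ← internalSet_empty] at hd
      filter_upwards [eventually_subset_of_internalSet_subset hd.subset] with k hk
      exact (measure_union (Set.disjoint_iff_inter_eq_empty.2 (Set.subset_empty_iff.1 hk))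
        (MeasurableSet.of_discrete)).symm)
  have hsub : C.IsSigmaSubadditive := by
    intro f hf hU
    choose B hB using hf
    obtain ⟨A, hA⟩ := hU
    obtain rfl : (fun i => internalSet u (B i)) = f := funext hB
    obtain ⟨N, hN⟩ := internalSet_exists_finite_subcover hu hA.subset
    have hEq : (⋃ i, internalSet u (B i)) = ⋃ i ∈ Finset.range N, internalSet u (B i) :=
      (hA ▸ hN).antisymm (Set.iUnion₂_subset_iUnion _ _)
    calc C (⋃ i, internalSet u (B i)) = C (⋃ i ∈ Finset.range N, internalSet u (B i)) := by
          rw [hEq]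
      _ ≤ ∑ i ∈ Finset.range N, C (internalSet u (B i)) :=
          addContent_biUnion_le hR fun i _ => ⟨_, rfl⟩
      _ ≤ _ := ENNReal.sum_le_tsum _
  refine ⟨C.measure hR.isSetSemiring hm.le hsub, fun A => ?_⟩
  rw [C.measure_eq hR.isSetSemiring hm hsub ⟨A, rfl⟩]
  change Tendsto _ _ (𝓝 (c _))
  rw [hc]
  exact hL A

end Loeb

section AbstractRemoval

open MeasureTheory
open scoped ENNReal symmDiff

variable {Ω I : Type*}

/-- The join of the `B e` over the subsets `e` of `f` with fewer than `l` elements. -/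
@[reducible] def lowerSigma (B : Finset I → MeasurableSpace Ω) (f : Finset I) (l : ℕ) :
    MeasurableSpace Ω :=
  ⨆ (e : Finset I) (_ : e ⊆ f ∧ e.card < l), B e

/-- The join of the `B e` over all `e` meeting `f` in fewer than `l` elements. -/
@[reducible] def crossSigma [DecidableEq I] (B : Finset I → MeasurableSpace Ω)
    (f : Finset I) (l : ℕ) : MeasurableSpace Ω :=
  ⨆ (e : Finset I) (_ : (e ∩ f).card < l), B e

/-- `p` is a conditional probability of `U` given the sets of size less than `l` inside `f`, and
conditioning further on everything meeting `f` in fewer than `l` elements does not change it. -/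
structure IsCondProb [DecidableEq I] [MeasurableSpace Ω] (B : Finset I → MeasurableSpace Ω)
    (μ : Measure Ω)
    (f : Finset I) (l : ℕ) (U : Set Ω) (p : Ω → ℝ≥0∞) : Prop where
  measurable : Measurable[lowerSigma B f l] p
  lintegral_eq : ∀ h : Ω → ℝ≥0∞, Measurable[crossSigma B f l] h →
    ∫⁻ x, U.indicator 1 x * h x ∂μ = ∫⁻ x, p x * h x ∂μ

variable {B : Finset I → MeasurableSpace Ω}

lemma le_crossSigma [DecidableEq I] {e f : Finset I} {l : ℕ} (h : (e ∩ f).card < l) :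
    B e ≤ crossSigma B f l :=
  le_iSup₂_of_le e h le_rfl

lemma le_lowerSigma {e f : Finset I} {l : ℕ} (h : e ⊆ f) (hl : e.card < l) :
    B e ≤ lowerSigma B f l :=
  le_iSup₂_of_le e ⟨h, hl⟩ le_rfl

lemma lowerSigma_le_crossSigma [DecidableEq I] (e f : Finset I) (l : ℕ) :
    lowerSigma B e l ≤ crossSigma B f l :=
  iSup₂_le fun _ hg => le_crossSigma ((card_le_card inter_subset_left).trans_lt hg.2)

lemma lowerSigma_mono_left {e f : Finset I} (h : e ⊆ f) (l : ℕ) :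
    lowerSigma B e l ≤ lowerSigma B f l :=
  iSup₂_le fun _ hg => le_lowerSigma (hg.1.trans h) hg.2

lemma lowerSigma_le (hB : Monotone B) (f : Finset I) (l : ℕ) : lowerSigma B f l ≤ B f :=
  iSup₂_le fun _ hg => hB hg.1

lemma lowerSigma_succ_le_crossSigma [DecidableEq I] {e f : Finset I} {l : ℕ} (he : e.card ≤ l)
    (hef : ¬ e ⊆ f) :
    lowerSigma B f (l + 1) ≤ crossSigma B e l := by
  refine iSup₂_le fun g hg => le_crossSigma ?_
  by_contra! hcon
  have h1 : g ∩ e = e := eq_of_subset_of_card_le inter_subset_right (he.trans hcon)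
  exact hef ((h1 ▸ inter_subset_left : e ⊆ g).trans hg.1)

lemma le_crossSigma_of_ne [DecidableEq I] {e g : Finset I} {l : ℕ} (he : e.card ≤ l)
    (hg : g.card ≤ l)
    (hne : g ≠ e) : B g ≤ crossSigma B e l := by
  refine le_crossSigma ?_
  by_contra! hcon
  have h1 : g ∩ e = e := eq_of_subset_of_card_le inter_subset_right (he.trans hcon)
  have h2 : g ∩ e = g := eq_of_subset_of_card_le inter_subset_left (hg.trans hcon)
  exact hne (h2.symm.trans h1)

lemma measurable_indicator_one {m : MeasurableSpace Ω} {s : Set Ω} (hs : MeasurableSet[m] s) :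
    Measurable[m] (s.indicator (1 : Ω → ℝ≥0∞)) :=
  Measurable.indicator measurable_const hs

/-- In an integral, indicators of sets of the `B e` may be replaced by conditional
probabilities. -/
lemma lintegral_prod_indicator_eq [DecidableEq I] [MeasurableSpace Ω] {μ : Measure Ω} {l : ℕ}
    {C : Finset I → Set Ω} {p : Finset I → Ω → ℝ≥0∞} (E : Finset (Finset I))
    (hE : ∀ e ∈ E, e.card ≤ l) (hC : ∀ e ∈ E, MeasurableSet[B e] (C e))
    (hp : ∀ e ∈ E, IsCondProb B μ e l (C e) (p e)) (w : Ω → ℝ≥0∞)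
    (hw : ∀ e ∈ E, Measurable[crossSigma B e l] w) :
    ∫⁻ x, w x * ∏ e ∈ E, (C e).indicator 1 x ∂μ = ∫⁻ x, w x * ∏ e ∈ E, p e x ∂μ := by
  induction E using Finset.induction_on generalizing w with
  | empty => simp
  | insert e E heE ih =>
    simp only [mem_insert, forall_eq_or_imp] at hE hC hp hw
    have h1 : Measurable[crossSigma B e l] fun x =>
        w x * ∏ g ∈ E, (C g).indicator (1 : Ω → ℝ≥0∞) x := by
      refine hw.1.mul (Finset.measurable_fun_prod _ fun g hg => ?_)
      refine measurable_indicator_one (le_crossSigma_of_ne hE.1 (hE.2 g hg) ?_ _ (hC.2 g hg))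
      rintro rfl
      exact heE hg
    have h2 := hp.1.lintegral_eq _ h1
    have h3 := ih hE.2 hC.2 hp.2 (fun x => w x * p e x) fun g hg =>
      (hw.2 g hg).mul (hp.1.measurable.mono (lowerSigma_le_crossSigma _ _ _) le_rfl)
    simp only [prod_insert heE]
    calc ∫⁻ x, w x * ((C e).indicator 1 x * ∏ g ∈ E, (C g).indicator 1 x) ∂μ
        = ∫⁻ x, p e x * (w x * ∏ g ∈ E, (C g).indicator 1 x) ∂μ := by
          rw [← h2]
          exact lintegral_congr fun x => by ring
      _ = ∫⁻ x, w x * p e x * ∏ g ∈ E, (C g).indicator 1 x ∂μ :=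
          lintegral_congr fun x => by ring
      _ = ∫⁻ x, w x * (p e x * ∏ g ∈ E, p g x) ∂μ := by
          rw [h3]
          exact lintegral_congr fun x => by ring

/-- The sets depending only on finite-valued `B e`-measurable colours, for `e ⊆ f` with fewer
than `l` elements. -/
def coloredSets (B : Finset I → MeasurableSpace Ω) (f : Finset I) (l : ℕ) : Set (Set Ω) :=
  {s | ∃ (κ : Type) (_ : Finite κ) (c : Finset I → Ω → κ),
    (∀ e k, MeasurableSet[B e] (c e ⁻¹' {k})) ∧
    ∀ x y, (∀ e, e ⊆ f → e.card < l → c e x = c e y) → (x ∈ s ↔ y ∈ s)}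

lemma isSetAlgebra_coloredSets (f : Finset I) (l : ℕ) :
    IsSetAlgebra (coloredSets B f l) where
  empty_mem := ⟨Unit, inferInstance, fun _ _ => (), fun e k => by simp, by simp⟩
  compl_mem := by
    rintro s ⟨κ, hκ, c, hc, hs⟩
    exact ⟨κ, hκ, c, hc, fun x y h => not_congr (hs x y h)⟩
  union_mem := by
    rintro s t ⟨κ, hκ, c, hc, hs⟩ ⟨κ', hκ', c', hc', ht⟩
    refine ⟨κ × κ', inferInstance, fun e x => (c e x, c' e x), fun e k => ?_, fun x y h => ?_⟩
    · convert (hc e k.1).inter (hc' e k.2) using 1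
      ext x
      simp [Prod.ext_iff]
    · have h1 := hs x y fun e he hl => (Prod.ext_iff.1 (h e he hl)).1
      have h2 := ht x y fun e he hl => (Prod.ext_iff.1 (h e he hl)).2
      exact or_congr h1 h2

lemma measurableSet_of_mem_coloredSets [Finite I] {f : Finset I} {l : ℕ} {s : Set Ω}
    (hs : s ∈ coloredSets B f l) : MeasurableSet[lowerSigma B f l] s := by
  obtain ⟨κ, hκ, c, hc, hs⟩ := hs
  have hEq : s = ⋃ v ∈ {v : Finset I → κ | ∃ x ∈ s, ∀ e, c e x = v e},
      ⋂ e ∈ {e : Finset I | e ⊆ f ∧ e.card < l}, c e ⁻¹' {v e} := by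
    ext y
    simp only [Set.mem_iUnion, Set.mem_iInter, Set.mem_ofPred_eq, Set.mem_preimage,
      Set.mem_singleton_iff, exists_prop]
    constructor
    · intro hy
      exact ⟨fun e => c e y, ⟨y, hy, fun _ => rfl⟩, fun _ _ => rfl⟩
    · rintro ⟨v, ⟨x, hx, hxv⟩, hyv⟩
      exact (hs x y fun e he hl => by rw [hxv, hyv e ⟨he, hl⟩]).1 hx
  rw [hEq]
  refine MeasurableSet.biUnion (Set.to_countable _) fun v _ => ?_
  refine MeasurableSet.biInter (Set.to_countable _) fun e he => ?_
  exact le_lowerSigma he.1 he.2 _ (hc e _)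

lemma lowerSigma_eq_generateFrom_coloredSets [Finite I] (f : Finset I) (l : ℕ) :
    lowerSigma B f l = MeasurableSpace.generateFrom (coloredSets B f l) := by
  classical
  refine le_antisymm (iSup₂_le fun e he U hU => ?_)
    (MeasurableSpace.generateFrom_le fun s hs => measurableSet_of_mem_coloredSets hs)
  apply MeasurableSpace.measurableSet_generateFrom
  refine ⟨Prop, inferInstance, fun g x => g = e ∧ x ∈ U, fun g k => ?_, fun x y h => ?_⟩
  · have : MeasurableSet[B g] {x | g = e ∧ x ∈ U} := by
      by_cases hg : g = e
      · subst hg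
        simpa using hU
      · simp [hg]
    by_cases hk : k
    · convert this using 1
      ext x
      simp [hk]
    · convert this.compl using 1
      ext x
      simp [hk]
  · simpa using h e he.1 he.2

lemma exists_coloredSets_measure_symmDiff_lt [Finite I] [m : MeasurableSpace Ω] {μ : Measure Ω}
    [IsFiniteMeasure μ] (f : Finset I) (l : ℕ) (hle : lowerSigma B f l ≤ m)
    {A : Set Ω} (hA : MeasurableSet[lowerSigma B f l] A) {η : ℝ≥0∞} (hη : 0 < η) :
    ∃ t ∈ coloredSets B f l, μ (t ∆ A) < η := by
  have halg := isSetAlgebra_coloredSets (B := B) f l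
  obtain ⟨t, ht, hlt⟩ := @exists_measure_symmDiff_lt_of_generateFrom_isSetRing Ω (lowerSigma B f l)
    (μ.trim hle) _ _ halg.isSetRing
    ⟨{Set.univ}, Set.countable_singleton _, by simpa using halg.univ_mem, by simp⟩
    (lowerSigma_eq_generateFrom_coloredSets f l) A hA η hη
  refine ⟨t, ht, ?_⟩
  rwa [trim_measurableSet_eq hle ((measurableSet_of_mem_coloredSets ht).symmDiff hA)] at hlt

lemma sum_measure_inter_le [MeasurableSpace Ω] {μ : Measure Ω} {ι : Type*} (V : Finset ι)
    {Q : ι → Set Ω} (hQ : ∀ v ∈ V, MeasurableSet (Q v))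
    (hd : (V : Set ι).PairwiseDisjoint Q) {S : Set Ω} (hS : MeasurableSet S) :
    ∑ v ∈ V, μ (Q v ∩ S) ≤ μ S := by
  rw [← measure_biUnion_finset (fun v hv w hw hvw => (hd hv hw hvw).mono Set.inter_subset_left
    Set.inter_subset_left) fun v hv => (hQ v hv).inter hS]
  exact measure_mono (Set.iUnion₂_subset fun v _ => Set.inter_subset_right)

variable [DecidableEq I]

/-- If the cell probability `P` dominates `K` times the conditional probability `q` of missing
`A` only on `D`, then the part outside `D` of the cells is small. -/
lemma measure_cell_sdiff_le [m : MeasurableSpace Ω] {μ : Measure Ω} {l : ℕ}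
    (hle : ∀ e, B e ≤ m) (hB : Monotone B) {f : Finset I} {E : Finset (Finset I)}
    (hE : ∀ e ∈ E, e ⊆ f ∧ e.card ≤ l)
    {C : Finset I → Set Ω} {p : Finset I → Ω → ℝ≥0∞}
    (hC : ∀ e ∈ E, MeasurableSet[B e] (C e)) (hp : ∀ e ∈ E, IsCondProb B μ e l (C e) (p e))
    {A : Set Ω} {q : Ω → ℝ≥0∞}
    (hq : IsCondProb B μ f l (Aᶜ ∩ ⋂ e ∈ E, C e) q) (hA : MeasurableSet A) (K : ℝ≥0∞) :
    μ ((⋂ e ∈ E, C e) \ {x | ∏ e ∈ E, p e x ≠ 0 ∧ K * q x ≤ ∏ e ∈ E, p e x}) ≤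
      K * μ ((⋂ e ∈ E, C e) \ A) := by
  classical
  have hpm : Measurable[lowerSigma B f l] fun x => ∏ e ∈ E, p e x :=
    Finset.measurable_fun_prod _ fun e he =>
      (hp e he).measurable.mono (lowerSigma_mono_left (hE e he).1 l) le_rfl
  set D : Set Ω := {x | ∏ e ∈ E, p e x ≠ 0 ∧ K * q x ≤ ∏ e ∈ E, p e x} with hD
  have hDm : MeasurableSet[lowerSigma B f l] D := by
    have h1 : MeasurableSet[lowerSigma B f l] {x | ∏ e ∈ E, p e x ≠ 0} :=
      hpm (measurableSet_singleton (0 : ℝ≥0∞)).compl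
    have h2 : MeasurableSet[lowerSigma B f l] {x | K * q x ≤ ∏ e ∈ E, p e x} :=
      measurableSet_le (hq.measurable.const_mul K) hpm
    exact h1.inter h2
  have hlow : lowerSigma B f l ≤ m := (lowerSigma_le hB f l).trans (hle f)
  have hCm : MeasurableSet (⋂ e ∈ E, C e) :=
    Finset.measurableSet_biInter _ fun e he => hle e _ (hC e he)
  have hind : ∀ x, Dᶜ.indicator (1 : Ω → ℝ≥0∞) x * ∏ e ∈ E, (C e).indicator 1 x =
      ((⋂ e ∈ E, C e) \ D).indicator 1 x := by
    intro x
    by_cases hx : x ∈ D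
    · simp [hx]
    · by_cases hx' : ∀ e ∈ E, x ∈ C e
      · rw [Finset.prod_congr rfl fun e he => Set.indicator_of_mem (hx' e he) _]
        simp only [Set.indicator, Set.mem_compl_iff, hx, not_false_eq_true, if_true, Pi.one_apply,
          Finset.prod_const_one, one_mul]
        rw [if_pos ⟨by simpa using hx', hx⟩]
      · rw [Set.indicator_of_notMem (s := _ \ _) (by simpa [hx] using hx')]
        push Not at hx'
        obtain ⟨e, he, hxe⟩ := hx'
        rw [Finset.prod_eq_zero he (by simp [hxe]), mul_zero]
  have hq1 : μ ((⋂ e ∈ E, C e) \ A) = ∫⁻ x, q x ∂μ := by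
    have := hq.lintegral_eq (fun _ => 1) measurable_const
    simp only [mul_one] at this
    rw [← this, lintegral_indicator_one (hA.compl.inter hCm), Set.inter_comm, Set.sdiff_eq]
  calc μ ((⋂ e ∈ E, C e) \ D)
      = ∫⁻ x, Dᶜ.indicator 1 x * ∏ e ∈ E, (C e).indicator 1 x ∂μ := by
        simp_rw [hind]
        rw [lintegral_indicator_one (hCm.diff (hlow _ hDm))]
    _ = ∫⁻ x, Dᶜ.indicator 1 x * ∏ e ∈ E, p e x ∂μ :=
        lintegral_prod_indicator_eq E (fun e he => (hE e he).2) hC hp _ fun e _ =>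
          measurable_indicator_one (lowerSigma_le_crossSigma _ _ _ _ hDm.compl)
    _ ≤ ∫⁻ x, K * q x ∂μ := by
        refine lintegral_mono fun x => ?_
        by_cases hx : x ∈ D
        · simp [hx]
        · simp only [Set.mem_compl_iff, hx, not_false_eq_true, Set.indicator_of_mem,
            Pi.one_apply, one_mul]
          simp only [hD, Set.mem_ofPred_eq, not_and_or, not_not, not_le] at hx
          rcases hx with hx | hx
          · simp [hx]
          · exact hx.le
    _ = K * μ ((⋂ e ∈ E, C e) \ A) := by
        rw [lintegral_const_mul _ (hq.measurable.mono hlow le_rfl), hq1]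

/-- If the cell probabilities dominate the conditional probabilities of missing the `A f` on a
set of positive measure, then the `A f` have a common intersection of positive measure. -/
lemma measure_biInter_pos_of_cell [m : MeasurableSpace Ω] {μ : Measure Ω} [IsFiniteMeasure μ]
    {l : ℕ} (hle : ∀ e, B e ≤ m) (hB : Monotone B) {F : Finset (Finset I)}
    {E : Finset I → Finset (Finset I)} (hE : ∀ f ∈ F, ∀ e, e ∈ E f ↔ e ⊆ f ∧ e.card ≤ l)
    {C : Finset I → Set Ω} {p : Finset I → Ω → ℝ≥0∞} (hC : ∀ e, MeasurableSet[B e] (C e))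
    (hp : ∀ e, IsCondProb B μ e l (C e) (p e)) {A : Finset I → Set Ω}
    {q : Finset I → Ω → ℝ≥0∞}
    (hA : ∀ f ∈ F, MeasurableSet[lowerSigma B f (l + 1)] (A f))
    (hq : ∀ f ∈ F, IsCondProb B μ f l ((A f)ᶜ ∩ ⋂ e ∈ E f, C e) (q f))
    (hpos : 0 < μ (⋂ f ∈ F, {x | ∏ e ∈ E f, p e x ≠ 0 ∧
      ((#F : ℝ≥0∞) + 1) * q f x ≤ ∏ e ∈ E f, p e x})) :
    0 < μ (⋂ f ∈ F, A f) := by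
  classical
  set K : ℝ≥0∞ := (#F : ℝ≥0∞) + 1 with hK
  set D : Finset I → Set Ω := fun f =>
    {x | ∏ e ∈ E f, p e x ≠ 0 ∧ K * q f x ≤ ∏ e ∈ E f, p e x} with hD
  have hlow : ∀ f k, lowerSigma B f k ≤ m := fun f k => (lowerSigma_le hB f k).trans (hle f)
  have hpm : ∀ f ∈ F, Measurable[lowerSigma B f l] fun x => ∏ e ∈ E f, p e x := fun f hf =>
    Finset.measurable_fun_prod _ fun e he =>
      (hp e).measurable.mono (lowerSigma_mono_left ((hE f hf e).1 he).1 l) le_rfl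
  have hDf : ∀ f ∈ F, MeasurableSet[lowerSigma B f l] (D f) := by
    intro f hf
    have h1 : MeasurableSet[lowerSigma B f l] {x | ∏ e ∈ E f, p e x ≠ 0} :=
      hpm f hf (measurableSet_singleton (0 : ℝ≥0∞)).compl
    have h2 : MeasurableSet[lowerSigma B f l] {x | K * q f x ≤ ∏ e ∈ E f, p e x} :=
      measurableSet_le ((hq f hf).measurable.const_mul K) (hpm f hf)
    exact h1.inter h2
  set D' : Set Ω := ⋂ f ∈ F, D f with hD'
  have hDm : ∀ g, MeasurableSet[crossSigma B g l] D' := fun g =>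
    Finset.measurableSet_biInter _ fun f hf => lowerSigma_le_crossSigma _ _ _ _ (hDf f hf)
  have hDm' : MeasurableSet D' :=
    Finset.measurableSet_biInter _ fun f hf => hlow _ _ _ (hDf f hf)
  let E' : Finset (Finset I) := F.biUnion E
  have hE' : ∀ e ∈ E', e.card ≤ l := by
    intro e he
    obtain ⟨f, hf, hef⟩ := Finset.mem_biUnion.1 he
    exact ((hE f hf e).1 hef).2
  have hQm : ∀ S : Finset (Finset I), MeasurableSet (⋂ e ∈ S, C e) := fun S =>
    Finset.measurableSet_biInter _ fun e _ => hle e _ (hC e)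
  have hind : ∀ (S : Finset (Finset I)) (x : Ω),
      ∏ e ∈ S, (C e).indicator (1 : Ω → ℝ≥0∞) x = (⋂ e ∈ S, C e).indicator 1 x := by
    intro S x
    by_cases hx : ∀ e ∈ S, x ∈ C e
    · rw [Finset.prod_congr rfl fun e he => Set.indicator_of_mem (hx e he) _,
        Set.indicator_of_mem (by simpa using hx)]
      simp
    · rw [Set.indicator_of_notMem (by simpa using hx)]
      push Not at hx
      obtain ⟨e, he, hxe⟩ := hx
      exact Finset.prod_eq_zero he (by simp [hxe])
  set R : Set Ω := D' ∩ ⋂ e ∈ E', C e with hR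
  have hRm : MeasurableSet R := hDm'.inter (hQm E')
  have hmR : μ R = ∫⁻ x, D'.indicator 1 x * ∏ e ∈ E', p e x ∂μ := by
    rw [← lintegral_prod_indicator_eq E' hE' (fun e _ => hC e) (fun e _ => hp e) _
      (fun e _ => measurable_indicator_one (hDm e)), ← lintegral_indicator_one hRm]
    refine lintegral_congr fun x => ?_
    rw [hind, hR, Set.inter_indicator_one]
    rfl
  have hRpos : μ R ≠ 0 := by
    rw [hmR, Ne, lintegral_eq_zero_iff]
    · intro h0
      refine hpos.ne' (measure_mono_null (fun x hx => ?_) (ae_iff.1 h0))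
      have hxD : x ∈ D' := hx
      simp only [Set.mem_ofPred_eq, Set.indicator_of_mem hxD, Pi.one_apply, one_mul,
        Pi.zero_apply]
      refine Finset.prod_ne_zero_iff.2 fun e he => ?_
      obtain ⟨f, hf, hef⟩ := Finset.mem_biUnion.1 he
      have := (Set.mem_iInter₂.1 hxD f hf).1
      exact Finset.prod_ne_zero_iff.1 this e hef
    · refine (measurable_indicator_one hDm').mul (Finset.measurable_fun_prod _ fun e _ => ?_)
      exact (hp e).measurable.mono (hlow _ _) le_rfl
  have hmiss : ∀ f ∈ F, K * μ (R \ A f) ≤ μ R := by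
    intro f hf
    have hAm : MeasurableSet (A f) := hlow _ _ _ (hA f hf)
    have hsub : E f ⊆ E' := Finset.subset_biUnion_of_mem E hf
    set U : Set Ω := (A f)ᶜ ∩ ⋂ e ∈ E f, C e with hU
    have hUlow : MeasurableSet[lowerSigma B f (l + 1)] U := by
      refine (hA f hf).compl.inter (Finset.measurableSet_biInter _ fun e he => ?_)
      have := (hE f hf e).1 he
      exact le_lowerSigma this.1 (Nat.lt_succ_of_le this.2) _ (hC e)
    have hcross : ∀ e ∈ E' \ E f, MeasurableSet[crossSigma B e l] U := by
      intro e he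
      rw [Finset.mem_sdiff, hE f hf] at he
      have h1 := hE' e he.1
      exact lowerSigma_succ_le_crossSigma h1 (fun h => he.2 ⟨h, h1⟩) _ hUlow
    have hRA : R \ A f = D' ∩ U ∩ ⋂ e ∈ E' \ E f, C e := by
      ext x
      simp only [hR, hU, Set.mem_sdiff, Set.mem_inter_iff, Set.mem_iInter, Set.mem_compl_iff,
        Finset.mem_sdiff]
      constructor
      · rintro ⟨⟨h1, h2⟩, h3⟩
        exact ⟨⟨h1, h3, fun e he => h2 e (hsub he)⟩, fun e he => h2 e he.1⟩
      · rintro ⟨⟨h1, h3, h4⟩, h5⟩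
        refine ⟨⟨h1, fun e he => ?_⟩, h3⟩
        by_cases h : e ∈ E f
        · exact h4 e h
        · exact h5 e ⟨he, h⟩
    have hpc : Measurable[crossSigma B f l] fun x =>
        D'.indicator 1 x * ∏ e ∈ E' \ E f, p e x :=
      (measurable_indicator_one (hDm f)).mul (Finset.measurable_fun_prod _ fun e _ =>
        (hp e).measurable.mono (lowerSigma_le_crossSigma _ _ _) le_rfl)
    have hcm : crossSigma B f l ≤ m := iSup₂_le fun e _ => hle e
    calc K * μ (R \ A f)
        = K * ∫⁻ x, (D' ∩ U).indicator 1 x * ∏ e ∈ E' \ E f, (C e).indicator 1 x ∂μ := by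
          rw [← lintegral_indicator_one (hRm.diff hAm)]
          congr 1
          refine lintegral_congr fun x => ?_
          rw [hind, hRA, Set.inter_indicator_one]
          rfl
      _ = K * ∫⁻ x, (D' ∩ U).indicator 1 x * ∏ e ∈ E' \ E f, p e x ∂μ := by
          rw [lintegral_prod_indicator_eq (E' \ E f)
            (fun e he => hE' e (Finset.mem_sdiff.1 he).1) (fun e _ => hC e) (fun e _ => hp e) _
            fun e he => measurable_indicator_one ((hDm e).inter (hcross e he))]
      _ = K * ∫⁻ x, q f x * (D'.indicator 1 x * ∏ e ∈ E' \ E f, p e x) ∂μ := by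
          rw [← (hq f hf).lintegral_eq _ hpc]
          congr 1
          refine lintegral_congr fun x => ?_
          rw [Set.inter_indicator_one, Pi.mul_apply]
          ring
      _ = ∫⁻ x, K * (q f x * (D'.indicator 1 x * ∏ e ∈ E' \ E f, p e x)) ∂μ :=
          (lintegral_const_mul _ (((hq f hf).measurable.mono (hlow _ _) le_rfl).mul
            (hpc.mono hcm le_rfl))).symm
      _ ≤ ∫⁻ x, D'.indicator 1 x * ∏ e ∈ E', p e x ∂μ := by
          refine lintegral_mono fun x => ?_
          by_cases hx : x ∈ D'
          · have h1 := (Set.mem_iInter₂.1 hx f hf).2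
            simp only [Set.indicator_of_mem hx, Pi.one_apply, one_mul]
            rw [← Finset.prod_sdiff hsub, ← mul_assoc, mul_comm]
            gcongr
          · simp [hx]
      _ = μ R := hmR.symm
  by_contra! hzero
  have hcov : R ⊆ (⋂ f ∈ F, A f) ∪ ⋃ f ∈ F, R \ A f := by
    intro x hx
    by_cases h : x ∈ ⋂ f ∈ F, A f
    · exact Or.inl h
    · right
      simp only [Set.mem_iInter, not_forall] at h
      obtain ⟨f, hf, hxf⟩ := h
      exact Set.mem_biUnion (Finset.mem_coe.2 hf) ⟨hx, hxf⟩
  have h1 : μ R ≤ ∑ f ∈ F, μ (R \ A f) := by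
    refine (measure_mono hcov).trans ((measure_union_le _ _).trans ?_)
    rw [le_antisymm hzero zero_le, zero_add]
    exact measure_biUnion_finset_le _ _
  have h2 : K * μ R ≤ #F * μ R := by
    calc K * μ R ≤ K * ∑ f ∈ F, μ (R \ A f) := by gcongr
      _ = ∑ f ∈ F, K * μ (R \ A f) := Finset.mul_sum _ _ _
      _ ≤ ∑ f ∈ F, μ R := Finset.sum_le_sum hmiss
      _ = #F * μ R := by simp
  rw [hK, add_mul, one_mul] at h2
  have h3 : (#F : ℝ≥0∞) * μ R ≠ ⊤ :=
    ENNReal.mul_ne_top (ENNReal.natCast_ne_top _) (measure_ne_top _ _)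
  have h4 := ENNReal.le_of_add_le_add_left h3 (h2.trans_eq (add_zero _).symm)
  exact hRpos (le_antisymm h4 zero_le)

/-- Points of `A` whose cell is not good for `A` lie in a small set. -/
lemma exists_bad_superset [Finite I] [m : MeasurableSpace Ω] {μ : Measure Ω} {l : ℕ}
    (hle : ∀ e, B e ≤ m) (hB : Monotone B) {f : Finset I} {E : Finset (Finset I)}
    (hE : ∀ e, e ∈ E ↔ e ⊆ f ∧ e.card ≤ l) {κ : Type*} [Finite κ] {c : Finset I → Ω → κ}
    (hc : ∀ e k, MeasurableSet[B e] (c e ⁻¹' {k})) {P : Finset I → Set Ω → Ω → ℝ≥0∞}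
    (hP : ∀ e U, MeasurableSet[B e] U → IsCondProb B μ e l U (P e U)) {A t : Set Ω}
    (hA : MeasurableSet[B f] A) (ht : MeasurableSet[B f] t)
    (htc : ∀ x y, (∀ e ∈ E, c e x = c e y) → (x ∈ t ↔ y ∈ t)) (K : ℝ≥0∞) :
    ∃ S, MeasurableSet[B f] S ∧ μ S ≤ (1 + K) * μ (t ∆ A) ∧
      ∀ x ∈ A, x ∉ S → ∏ e ∈ E, P e (c e ⁻¹' {c e x}) x ≠ 0 ∧
        K * P f (Aᶜ ∩ ⋂ e ∈ E, c e ⁻¹' {c e x}) x ≤ ∏ e ∈ E, P e (c e ⁻¹' {c e x}) x := by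
  classical
  have := Fintype.ofFinite I
  have := Fintype.ofFinite κ
  rcases isEmpty_or_nonempty Ω with hΩ | ⟨⟨x₀⟩⟩
  · exact ⟨∅, by simp, by simp, fun x => hΩ.elim x⟩
  let V : Finset (Finset I → κ) :=
    Fintype.piFinset fun e => if e ∈ E then Finset.univ else {c e x₀}
  have hV : ∀ v ∈ V, ∀ e ∉ E, v e = c e x₀ := by
    intro v hv e he
    have := Fintype.mem_piFinset.1 hv e
    simpa [he] using this
  let Q : (Finset I → κ) → Set Ω := fun v => ⋂ e ∈ E, c e ⁻¹' {v e}
  have hmQ : ∀ v x, x ∈ Q v ↔ ∀ e ∈ E, c e x = v e := by simp [Q]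
  let D : (Finset I → κ) → Set Ω := fun v =>
    {x | ∏ e ∈ E, P e (c e ⁻¹' {v e}) x ≠ 0 ∧
      K * P f (Aᶜ ∩ Q v) x ≤ ∏ e ∈ E, P e (c e ⁻¹' {v e}) x}
  have hQm : ∀ v, MeasurableSet[B f] (Q v) := fun v =>
    Finset.measurableSet_biInter _ fun e he => hB ((hE e).1 he).1 _ (hc e _)
  have hDm : ∀ v, MeasurableSet[B f] (D v) := by
    intro v
    have hpm : Measurable[B f] fun x => ∏ e ∈ E, P e (c e ⁻¹' {v e}) x :=
      Finset.measurable_fun_prod _ fun e he => (hP e _ (hc e _)).measurable.mono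
        ((lowerSigma_le hB e l).trans (hB ((hE e).1 he).1)) le_rfl
    have h1 : MeasurableSet[B f] {x | ∏ e ∈ E, P e (c e ⁻¹' {v e}) x ≠ 0} :=
      hpm (measurableSet_singleton (0 : ℝ≥0∞)).compl
    have h2 : MeasurableSet[B f]
        {x | K * P f (Aᶜ ∩ Q v) x ≤ ∏ e ∈ E, P e (c e ⁻¹' {v e}) x} :=
      measurableSet_le (((hP f _ (hA.compl.inter (hQm v))).measurable.mono
        (lowerSigma_le hB f l) le_rfl).const_mul K) hpm
    exact h1.inter h2
  have hcell : ∀ v, μ ((Q v ∩ t) \ D v) ≤ K * μ (Q v ∩ (t \ A)) := by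
    intro v
    rcases (Q v ∩ t).eq_empty_or_nonempty with h | ⟨x, hxQ, hxt⟩
    · simp [h]
    · have hsub : Q v ⊆ t := fun y hy =>
        (htc x y fun e he => ((hmQ v x).1 hxQ e he).trans ((hmQ v y).1 hy e he).symm).1 hxt
      have h1 : Q v ∩ (t \ A) = Q v \ A := by
        rw [← Set.inter_sdiff_assoc, Set.inter_eq_left.2 hsub]
      rw [Set.inter_eq_left.2 hsub, h1]
      exact measure_cell_sdiff_le hle hB (fun e he => (hE e).1 he) (fun e _ => hc e _)
        (fun e _ => hP e _ (hc e _)) (hP f _ (hA.compl.inter (hQm v))) (hle f _ hA) K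
  refine ⟨(A \ t) ∪ ⋃ v ∈ V, (Q v ∩ t) \ D v, (hA.diff ht).union
    (Finset.measurableSet_biUnion _ fun v _ => ((hQm v).inter ht).diff (hDm v)), ?_, ?_⟩
  · have hdisj : (V : Set (Finset I → κ)).PairwiseDisjoint Q := by
      intro v hv w hw hvw
      refine Set.disjoint_left.2 fun x hxv hxw => hvw (funext fun e => ?_)
      by_cases he : e ∈ E
      · rw [← (hmQ v x).1 hxv e he, (hmQ w x).1 hxw e he]
      · rw [hV v hv e he, hV w hw e he]
    calc μ ((A \ t) ∪ ⋃ v ∈ V, (Q v ∩ t) \ D v)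
        ≤ μ (A \ t) + ∑ v ∈ V, μ ((Q v ∩ t) \ D v) :=
          (measure_union_le _ _).trans (by gcongr; exact measure_biUnion_finset_le _ _)
      _ ≤ μ (A \ t) + ∑ v ∈ V, K * μ (Q v ∩ (t \ A)) := by gcongr with v; exact hcell v
      _ ≤ μ (A \ t) + K * μ (t \ A) := by
          rw [← Finset.mul_sum]
          gcongr
          exact sum_measure_inter_le V (fun v _ => hle f _ (hQm v)) hdisj
            (hle f _ (ht.diff hA))
      _ ≤ μ (t ∆ A) + K * μ (t ∆ A) := by
          gcongr
          · exact Set.subset_union_right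
          · exact Set.subset_union_left
      _ = (1 + K) * μ (t ∆ A) := by ring
  · intro x hxA hxS
    have hxt : x ∈ t := by
      by_contra h
      exact hxS (Or.inl ⟨hxA, h⟩)
    let v : Finset I → κ := fun e => if e ∈ E then c e x else c e x₀
    have hv : ∀ e ∈ E, v e = c e x := fun e he => if_pos he
    have hvV : v ∈ V := by
      refine Fintype.mem_piFinset.2 fun e => ?_
      by_cases he : e ∈ E <;> simp [v, he]
    have hxD : x ∈ D v := by
      by_contra h
      refine hxS (Or.inr (Set.mem_biUnion (Finset.mem_coe.2 hvV) ⟨⟨?_, hxt⟩, h⟩))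
      exact (hmQ v x).2 fun e he => (hv e he).symm
    have h1 : ∏ e ∈ E, P e (c e ⁻¹' {v e}) x = ∏ e ∈ E, P e (c e ⁻¹' {c e x}) x :=
      Finset.prod_congr rfl fun e he => by rw [hv e he]
    have h2 : Q v = ⋂ e ∈ E, c e ⁻¹' {c e x} :=
      Set.iInter₂_congr fun e he => by rw [hv e he]
    have h3 := hxD
    simp only [D, Set.mem_ofPred_eq, h1, h2] at h3
    exact h3

/-- Abstract removal theorem: if some nonzero finite measure `ν`, bounded by `C • μ` on each
`B f`, is carried by each of the sets `A f`, then these have a common intersection of positive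
`μ`-measure. -/
theorem measure_biInter_pos_of_carrier [Finite I] [m : MeasurableSpace Ω] {μ : Measure Ω}
    [IsProbabilityMeasure μ] (hle : ∀ e, B e ≤ m) (hB : Monotone B)
    (hCI : ∀ f l U, MeasurableSet[B f] U → ∃ p, IsCondProb B μ f l U p)
    (F : Finset (Finset I)) {C : ℝ≥0∞} (hC : C ≠ ⊤) (l : ℕ) (ν : Measure Ω) [IsFiniteMeasure ν]
    (hν : ν Set.univ ≠ 0) (hνμ : ∀ f ∈ F, ∀ U, MeasurableSet[B f] U → ν U ≤ C * μ U)
    {A : Finset I → Set Ω} (hA : ∀ f ∈ F, MeasurableSet[lowerSigma B f l] (A f))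
    (hνA : ∀ f ∈ F, ν (A f)ᶜ = 0) : 0 < μ (⋂ f ∈ F, A f) := by
  classical
  have := Fintype.ofFinite I
  induction l generalizing ν A with
  | zero =>
    have hAuniv : ∀ f ∈ F, A f = Set.univ := by
      intro f hf
      have h1 := hA f hf
      have hbot : lowerSigma B f 0 = ⊥ := by simp [lowerSigma]
      rw [hbot, MeasurableSpace.measurableSet_bot_iff] at h1
      refine h1.resolve_left fun h => hν ?_
      have := hνA f hf
      rwa [h, Set.compl_empty] at this
    rw [Set.iInter₂_congr hAuniv]
    simp
  | succ l ih =>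
    set K : ℝ≥0∞ := (#F : ℝ≥0∞) + 1 with hK
    have hK' : #F * (C * (1 + K)) ≠ ⊤ := by finiteness
    obtain ⟨η, hη, hηlt⟩ := ENNReal.exists_nnreal_pos_mul_lt hK' hν
    have hlow : ∀ f j, lowerSigma B f j ≤ m := fun f j => (lowerSigma_le hB f j).trans (hle f)
    have happ : ∀ f : F, ∃ t ∈ coloredSets B f.1 (l + 1), μ (t ∆ A f.1) < η := fun f =>
      exists_coloredSets_measure_symmDiff_lt f.1 (l + 1) (hlow _ _) (hA f.1 f.2)
        (by exact_mod_cast hη)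
    choose t ht htA using happ
    choose κ hκ c hc hct using ht
    let κ' := ∀ f, κ f
    let c' : Finset I → Ω → κ' := fun e x f => c f e x
    have hc' : ∀ e k, MeasurableSet[B e] (c' e ⁻¹' {k}) := by
      intro e k
      have h1 : c' e ⁻¹' {k} = ⋂ f, c f e ⁻¹' {k f} := by
        ext x
        simp only [Set.mem_preimage, Set.mem_singleton_iff, Set.mem_iInter]
        exact funext_iff
      rw [h1]
      exact MeasurableSet.iInter fun f => hc f e _
    have hP : ∀ f U, ∃ p, MeasurableSet[B f] U → IsCondProb B μ f l U p := by
      intro f U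
      by_cases hU : MeasurableSet[B f] U
      · obtain ⟨p, hp⟩ := hCI f l U hU
        exact ⟨p, fun _ => hp⟩
      · exact ⟨0, fun h => absurd h hU⟩
    choose P hP using hP
    let E : Finset I → Finset (Finset I) := fun f => f.powerset.filter fun e => e.card ≤ l
    have hE : ∀ f e, e ∈ E f ↔ e ⊆ f ∧ e.card ≤ l := by simp [E]
    have hAB : ∀ f ∈ F, MeasurableSet[B f] (A f) := fun f hf =>
      lowerSigma_le hB f _ _ (hA f hf)
    have hbad : ∀ f : F, ∃ S, MeasurableSet[B f.1] S ∧ μ S ≤ (1 + K) * μ (t f ∆ A f.1) ∧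
        ∀ x ∈ A f.1, x ∉ S → ∏ e ∈ E f, P e (c' e ⁻¹' {c' e x}) x ≠ 0 ∧
          K * P f ((A f)ᶜ ∩ ⋂ e ∈ E f, c' e ⁻¹' {c' e x}) x ≤
            ∏ e ∈ E f, P e (c' e ⁻¹' {c' e x}) x := by
      intro f
      refine exists_bad_superset hle hB (hE f) hc' hP (hAB f.1 f.2)
        (lowerSigma_le hB f.1 (l + 1) _
          (measurableSet_of_mem_coloredSets ⟨κ f, hκ f, c f, hc f, hct f⟩)) ?_ K
      intro x y hxy
      refine hct f x y fun e he hel => ?_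
      exact congrFun (hxy e ((hE f e).2 ⟨he, Nat.le_of_lt_succ hel⟩)) f
    choose S hSm hSμ hSD using hbad
    let D : (Finset I → κ') → Finset I → Set Ω := fun v f =>
      {x | ∏ e ∈ E f, P e (c' e ⁻¹' {v e}) x ≠ 0 ∧
        K * P f ((A f)ᶜ ∩ ⋂ e ∈ E f, c' e ⁻¹' {v e}) x ≤ ∏ e ∈ E f, P e (c' e ⁻¹' {v e}) x}
    have hUm : ∀ v : Finset I → κ', ∀ f ∈ F,
        MeasurableSet[B f] ((A f)ᶜ ∩ ⋂ e ∈ E f, c' e ⁻¹' {v e}) :=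
      fun v f hf => (hAB f hf).compl.inter (Finset.measurableSet_biInter _ fun e he =>
        hB ((hE f e).1 he).1 _ (hc' e _))
    have hDm : ∀ v, ∀ f ∈ F, MeasurableSet[lowerSigma B f l] (D v f) := by
      intro v f hf
      have hpm : Measurable[lowerSigma B f l] fun x => ∏ e ∈ E f, P e (c' e ⁻¹' {v e}) x :=
        Finset.measurable_fun_prod _ fun e he => (hP e _ (hc' e _)).measurable.mono
          (lowerSigma_mono_left ((hE f e).1 he).1 l) le_rfl
      have h1 : MeasurableSet[lowerSigma B f l]
          {x | ∏ e ∈ E f, P e (c' e ⁻¹' {v e}) x ≠ 0} :=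
        hpm (measurableSet_singleton (0 : ℝ≥0∞)).compl
      have h2 : MeasurableSet[lowerSigma B f l]
          {x | K * P f ((A f)ᶜ ∩ ⋂ e ∈ E f, c' e ⁻¹' {v e}) x ≤
            ∏ e ∈ E f, P e (c' e ⁻¹' {v e}) x} :=
        measurableSet_le ((hP f _ (hUm v f hf)).measurable.const_mul K) hpm
      exact h1.inter h2
    have hcov : Set.univ ⊆ (⋃ f : F, (A f)ᶜ) ∪ (⋃ f : F, S f) ∪ ⋃ v, ⋂ f ∈ F, D v f := by
      intro x _
      by_contra h
      simp only [Set.mem_union, Set.mem_iUnion, not_or, not_exists, Set.mem_compl_iff,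
        not_not] at h
      refine h.2 (fun e => c' e x) (Set.mem_iInter₂.2 fun f hf => ?_)
      exact hSD ⟨f, hf⟩ x (h.1.1 ⟨f, hf⟩) (h.1.2 ⟨f, hf⟩)
    have hSν : ν (⋃ f : F, S f) < ν Set.univ := by
      refine lt_of_le_of_lt ?_ hηlt
      calc ν (⋃ f : F, S f) ≤ ∑ f : F, ν (S f) := measure_iUnion_fintype_le _ _
        _ ≤ ∑ f : F, C * ((1 + K) * η) := by
            gcongr with f
            refine (hνμ f f.2 _ (hSm f)).trans ?_
            gcongr
            exact (hSμ f).trans (by gcongr; exact (htA f).le)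
        _ = η * (#F * (C * (1 + K))) := by
            simp only [Finset.sum_const, Finset.card_univ, Fintype.card_coe, nsmul_eq_mul]
            ring
    have hv : ∃ v, ν (⋂ f ∈ F, D v f) ≠ 0 := by
      by_contra! h
      refine hSν.not_ge ?_
      calc ν Set.univ ≤ _ := measure_mono hcov
        _ ≤ ν (⋃ f : F, (A f)ᶜ) + ν (⋃ f : F, S f) + ν (⋃ v, ⋂ f ∈ F, D v f) :=
            (measure_union_le _ _).trans (by gcongr; exact measure_union_le _ _)
        _ = ν (⋃ f : F, S f) := by
            rw [measure_iUnion_null fun f : F => hνA f f.2, measure_iUnion_null h, zero_add,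
              add_zero]
    obtain ⟨v, hv⟩ := hv
    refine measure_biInter_pos_of_cell hle hB (fun f _ => hE f) (fun e => hc' e (v e))
      (fun e => hP e _ (hc' e (v e))) hA (fun f hf => hP f _ (hUm v f hf)) ?_
    refine ih (ν.restrict (⋂ f ∈ F, D v f)) (by simpa using hv) (fun f hf U hU =>
      (Measure.restrict_apply_le _ _).trans (hνμ f hf U hU)) (hDm v) fun f hf => ?_
    rw [Measure.restrict_apply (hlow _ _ _ (hDm v f hf)).compl]
    convert measure_empty (μ := ν) using 2
    refine Set.disjoint_iff_inter_eq_empty.1 (Set.disjoint_left.2 fun x hx hx' => ?_)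
    exact hx (Set.mem_iInter₂.1 hx' f hf)

end AbstractRemoval

section CylinderSigma

open MeasureTheory Filter Topology ProbabilityTheory
open scoped ENNReal symmDiff

variable {α : Type*}

/-- `A` depends only on the coordinates in `e`. -/
def IsCylinder {V : Type*} (e : Finset α) (A : Set (α → V)) : Prop :=
  ∀ ⦃x y : α → V⦄, (∀ i ∈ e, x i = y i) → (x ∈ A ↔ y ∈ A)

lemma IsCylinder.mono {V : Type*} {e f : Finset α} (h : e ⊆ f) {A : Set (α → V)}
    (hA : IsCylinder e A) : IsCylinder f A :=
  fun _ _ hxy => hA fun i hi => hxy i (h hi)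

lemma IsCylinder.compl {V : Type*} {e : Finset α} {A : Set (α → V)} (hA : IsCylinder e A) :
    IsCylinder e Aᶜ :=
  fun _ _ hxy => not_congr (hA hxy)

lemma IsCylinder.union {V : Type*} {e : Finset α} {A A' : Set (α → V)} (hA : IsCylinder e A)
    (hA' : IsCylinder e A') : IsCylinder e (A ∪ A') :=
  fun _ _ hxy => or_congr (hA hxy) (hA' hxy)

lemma IsCylinder.preimage_piecewise {V : Type*} [DecidableEq α] {e : Finset α}
    {A : Set (α → V)} (hA : IsCylinder e A) (f : Finset α) (y : α → V) :
    IsCylinder (e ∩ f) {x | f.piecewise x y ∈ A} := by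
  intro x x' h
  refine hA fun i hi => ?_
  by_cases hif : i ∈ f
  · simp [hif, h i (Finset.mem_inter.2 ⟨hi, hif⟩)]
  · simp [hif]

lemma exists_abs_sum_indicator_le {V : Type*} [Fintype α] [DecidableEq α] [Fintype V]
    [Nonempty V] (f : Finset α) {G : (α → V) → ℝ} (hG : ∀ x y, (∀ i ∈ f, x i = y i) → G x = G y)
    (S : Set (α → V)) :
    ∃ y, |∑ x, S.indicator G x| ≤ |∑ x, {x | f.piecewise x y ∈ S}.indicator G x| := by
  classical
  by_contra! hcon
  let σ : (α → V) × (α → V) → (α → V) × (α → V) := fun z =>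
    (f.piecewise z.1 z.2, f.piecewise z.2 z.1)
  have hσ : Function.Involutive σ := by
    intro z
    refine Prod.ext (funext fun i => ?_) (funext fun i => ?_) <;>
    · by_cases hi : i ∈ f <;> simp [σ, hi]
  have h1 : ∑ y : α → V, ∑ x, S.indicator G x =
      ∑ y : α → V, ∑ x, {x | f.piecewise x y ∈ S}.indicator G x := by
    rw [← Finset.sum_product', ← Finset.sum_product']
    refine Fintype.sum_equiv (hσ.toPerm σ) _ _ fun z => ?_
    have hz : f.piecewise (σ z).2 (σ z).1 = z.2 := congrArg Prod.snd (hσ z)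
    have hGz : G (σ z).2 = G z.2 := hG _ _ fun i hi => by simp [σ, hi]
    simp only [Set.indicator, Function.Involutive.coe_toPerm, Set.mem_ofPred_eq, hz, hGz]
  have h2 : |∑ y : α → V, ∑ x, S.indicator G x| = ∑ y : α → V, |∑ x, S.indicator G x| := by
    simp [abs_mul]
  have h3 : ∑ y : α → V, |∑ x, {x | f.piecewise x y ∈ S}.indicator G x| <
      ∑ y : α → V, |∑ x, S.indicator G x| :=
    Finset.sum_lt_sum_of_nonempty Finset.univ_nonempty fun y _ => hcon y
  rw [← h2, h1] at h3
  exact h3.not_ge (Finset.abs_sum_le_sum_abs _ _)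

lemma exists_abs_setIntegral_uniformOn_le {V : Type*} [Fintype α] [DecidableEq α] [Fintype V]
    [Nonempty V] [MeasurableSpace (α → V)] [DiscreteMeasurableSpace (α → V)] (f : Finset α)
    {G : (α → V) → ℝ} (hG : ∀ x y, (∀ i ∈ f, x i = y i) → G x = G y) (S : Set (α → V)) :
    ∃ y, |∫ x in S, G x ∂uniformOn Set.univ| ≤
      |∫ x in {x | f.piecewise x y ∈ S}, G x ∂uniformOn Set.univ| := by
  have h : ∀ T : Set (α → V), ∫ x in T, G x ∂uniformOn Set.univ =
      (Fintype.card (α → V) : ℝ)⁻¹ * ∑ x, T.indicator G x := by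
    intro T
    rw [← integral_indicator (MeasurableSet.of_discrete), integral_fintype Integrable.of_finite,
      Finset.mul_sum]
    refine Finset.sum_congr rfl fun x _ => ?_
    have : (uniformOn (Set.univ : Set (α → V))).real {x} = (Fintype.card (α → V) : ℝ)⁻¹ := by
      simp [Measure.real, uniformOn_univ]
    rw [this, smul_eq_mul]
  obtain ⟨y, hy⟩ := exists_abs_sum_indicator_le f hG S
  refine ⟨y, ?_⟩
  rw [h, h, abs_mul, abs_mul]
  gcongr

variable {V : ℕ → Type*} {u : Ultrafilter ℕ}

/-- The internal sets depending only on the coordinates in `e`. -/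
def internalCylinders (u : Ultrafilter ℕ) (V : ℕ → Type*) (e : Finset α) :
    Set (Set (∀ k, α → V k)) :=
  {s | ∃ A : ∀ k, Set (α → V k), (∀ k, IsCylinder e (A k)) ∧ internalSet u A = s}

/-- The σ-algebra of events depending only on the coordinates in `e`. -/
@[reducible] def cylinderSigma (u : Ultrafilter ℕ) (V : ℕ → Type*) (e : Finset α) :
    MeasurableSpace (∀ k, α → V k) :=
  MeasurableSpace.generateFrom (internalCylinders u V e)

lemma isSetAlgebra_internalCylinders (e : Finset α) :
    IsSetAlgebra (internalCylinders u V e) where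
  empty_mem := ⟨fun _ => ∅, fun _ _ _ _ => Iff.rfl, internalSet_empty⟩
  compl_mem := by
    rintro _ ⟨A, hA, rfl⟩
    exact ⟨_, fun k => (hA k).compl, (internalSet_compl A).symm⟩
  union_mem := by
    rintro _ _ ⟨A, hA, rfl⟩ ⟨A', hA', rfl⟩
    exact ⟨_, fun k => (hA k).union (hA' k), (internalSet_union A A').symm⟩

lemma cylinderSigma_mono : Monotone (cylinderSigma (α := α) u V) := by
  intro e f hef
  refine MeasurableSpace.generateFrom_mono ?_
  rintro _ ⟨A, hA, rfl⟩
  exact ⟨A, fun k => (hA k).mono hef, rfl⟩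

lemma cylinderSigma_le (e : Finset α) :
    cylinderSigma u V e ≤ MeasurableSpace.generateFrom (Set.range (internalSet u)) := by
  refine MeasurableSpace.generateFrom_mono ?_
  rintro _ ⟨A, hA, rfl⟩
  exact ⟨A, rfl⟩

lemma exists_internalCylinder_measure_symmDiff_lt [m : MeasurableSpace (∀ k, α → V k)]
    {e : Finset α} (hle : cylinderSigma u V e ≤ m) (μ : Measure (∀ k, α → V k))
    [IsFiniteMeasure μ] {U : Set (∀ k, α → V k)} (hU : MeasurableSet[cylinderSigma u V e] U)
    {η : ℝ≥0∞} (hη : 0 < η) :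
    ∃ A : ∀ k, Set (α → V k), (∀ k, IsCylinder e (A k)) ∧ μ (internalSet u A ∆ U) < η := by
  have halg := isSetAlgebra_internalCylinders (V := V) (u := u) e
  obtain ⟨t, ⟨A, hA, rfl⟩, hlt⟩ := @exists_measure_symmDiff_lt_of_generateFrom_isSetRing _
    (cylinderSigma u V e) (μ.trim hle) _ _ halg.isSetRing
    ⟨{Set.univ}, Set.countable_singleton _, by simpa using halg.univ_mem, by simp⟩ rfl U hU η hη
  refine ⟨A, hA, ?_⟩
  have hAm : MeasurableSet[cylinderSigma u V e] (internalSet u A) :=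
    MeasurableSpace.measurableSet_generateFrom ⟨A, hA, rfl⟩
  rwa [trim_measurableSet_eq hle (hAm.symmDiff hU)] at hlt

lemma measure_le_of_internalCylinders [m : MeasurableSpace (∀ k, α → V k)]
    {e : Finset α} (hle : cylinderSigma u V e ≤ m) {μ ν : Measure (∀ k, α → V k)}
    [IsFiniteMeasure μ] [IsFiniteMeasure ν] {C : ℝ≥0∞} (hC : C ≠ ⊤)
    (h : ∀ A : ∀ k, Set (α → V k), (∀ k, IsCylinder e (A k)) →
      ν (internalSet u A) ≤ C * μ (internalSet u A))
    {U : Set (∀ k, α → V k)} (hU : MeasurableSet[cylinderSigma u V e] U) : ν U ≤ C * μ U := by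
  refine ENNReal.le_of_forall_pos_le_add fun ε hε _ => ?_
  obtain ⟨η, hη, hηlt⟩ := ENNReal.exists_nnreal_pos_mul_lt (a := C + 1) (b := ε)
    (by finiteness) (by exact_mod_cast hε.ne')
  obtain ⟨A, hA, hlt⟩ := exists_internalCylinder_measure_symmDiff_lt hle (μ + ν) hU
    (η := η) (by exact_mod_cast hη)
  rw [Measure.add_apply] at hlt
  have h1 : U ⊆ internalSet u A ∪ internalSet u A ∆ U := by
    intro x hx
    by_cases hxA : x ∈ internalSet u A
    · exact Or.inl hxA
    · exact Or.inr (Or.inr ⟨hx, hxA⟩)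
  have h2 : internalSet u A ⊆ U ∪ internalSet u A ∆ U := by
    intro x hx
    by_cases hxU : x ∈ U
    · exact Or.inl hxU
    · exact Or.inr (Or.inl ⟨hx, hxU⟩)
  have h3 : μ (internalSet u A ∆ U) ≤ η := (le_self_add.trans hlt.le)
  have h4 : ν (internalSet u A ∆ U) ≤ η := (le_add_self.trans hlt.le)
  calc ν U ≤ ν (internalSet u A) + ν (internalSet u A ∆ U) :=
        (measure_mono h1).trans (measure_union_le _ _)
    _ ≤ C * (μ U + η) + η := by
        gcongr
        refine (h A hA).trans ?_
        gcongr
        exact (measure_mono h2).trans ((measure_union_le _ _).trans (by gcongr))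
    _ = C * μ U + η * (C + 1) := by ring
    _ ≤ C * μ U + ε := by gcongr

section CondProb

variable [Fintype α] [∀ k, Fintype (V k)]
  [∀ k, MeasurableSpace (α → V k)] [∀ k, DiscreteMeasurableSpace (α → V k)]
  [m : MeasurableSpace (∀ k, α → V k)] {μ : Measure (∀ k, α → V k)} [IsFiniteMeasure μ]

/-- Functions measurable with respect to the coordinates in `f` are approximated, uniformly over
integrals on internal sets, by sequences of functions depending on these coordinates. -/
lemma exists_setIntegral_approx {f : Finset α} (hle : cylinderSigma u V f ≤ m)
    (hm : MeasurableSpace.generateFrom (Set.range (internalSet u)) ≤ m)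
    (hμ : ∀ A : ∀ k, Set (α → V k),
      Tendsto (fun k => uniformOn Set.univ (A k)) u (𝓝 (μ (internalSet u A))))
    {g₀ : (∀ k, α → V k) → ℝ} (hg₀ : StronglyMeasurable[cylinderSigma u V f] g₀)
    (hint : Integrable g₀ μ) {ε : ℝ} (hε : 0 < ε) :
    ∃ (g : (∀ k, α → V k) → ℝ) (G : ∀ k, (α → V k) → ℝ),
      (∀ k x y, (∀ i ∈ f, x i = y i) → G k x = G k y) ∧
      (∀ S : ∀ k, Set (α → V k), Tendsto (fun k => ∫ x in S k, G k x ∂uniformOn Set.univ) u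
        (𝓝 (∫ x in internalSet u S, g x ∂μ))) ∧
      ∀ S, |∫ x in S, g₀ x ∂μ - ∫ x in S, g x ∂μ| ≤ ε := by
  have hmeas : ∀ A : ∀ k, Set (α → V k), MeasurableSet (internalSet u A) := fun A =>
    hm _ (MeasurableSpace.measurableSet_generateFrom ⟨A, rfl⟩)
  let P : ((∀ k, α → V k) → ℝ) → Prop := fun g => Integrable g μ ∧
    AEStronglyMeasurable[cylinderSigma u V f] g (μ.trim hle) ∧
    ∃ G : ∀ k, (α → V k) → ℝ, (∀ k x y, (∀ i ∈ f, x i = y i) → G k x = G k y) ∧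
      ∀ S : ∀ k, Set (α → V k), Tendsto (fun k => ∫ x in S k, G k x ∂uniformOn Set.univ) u
        (𝓝 (∫ x in internalSet u S, g x ∂μ))
  have hMemLp : @MemLp _ _ (cylinderSigma u V f) _ _ g₀ 1 (μ.trim hle) :=
    memLp_one_iff_integrable.2 (hint.trim hle hg₀)
  have h0P : ∀ (c : ℝ) ⦃s : Set (∀ k, α → V k)⦄, MeasurableSet[cylinderSigma u V f] s →
      μ.trim hle s < ∞ → ∀ {η : ℝ≥0∞}, η ≠ 0 → ∃ g : (∀ k, α → V k) → ℝ,
      @eLpNorm _ _ _ (cylinderSigma u V f) (g - s.indicator fun _ => c) 1 (μ.trim hle) ≤ η ∧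
        P g := by
    intro c s hs _ η hη
    obtain ⟨δ, hδ, hδ'⟩ := ENNReal.exists_nnreal_pos_mul_lt (a := ‖c‖ₑ) enorm_ne_top hη
    obtain ⟨A, hA, hlt⟩ := exists_internalCylinder_measure_symmDiff_lt hle μ hs
      (η := δ) (by exact_mod_cast hδ)
    have hAm : MeasurableSet[cylinderSigma u V f] (internalSet u A) :=
      MeasurableSpace.measurableSet_generateFrom ⟨A, hA, rfl⟩
    have hm1 : StronglyMeasurable[cylinderSigma u V f] ((internalSet u A).indicator fun _ => c) :=
      stronglyMeasurable_const.indicator hAm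
    have hm2 : StronglyMeasurable[cylinderSigma u V f] (s.indicator fun _ => c) :=
      stronglyMeasurable_const.indicator hs
    refine ⟨(internalSet u A).indicator fun _ => c, ?_, ?_, ?_, ?_⟩
    · rw [eLpNorm_trim hle (hm1.sub hm2), eLpNorm_one_eq_lintegral_enorm]
      calc ∫⁻ x, ‖((internalSet u A).indicator (fun _ => c) - s.indicator fun _ => c) x‖ₑ ∂μ
          = ∫⁻ x, (internalSet u A ∆ s).indicator (fun _ => ‖c‖ₑ) x ∂μ := by
            refine lintegral_congr fun x => ?_
            by_cases h1 : x ∈ internalSet u A <;> by_cases h2 : x ∈ s <;>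
              simp [h1, h2, Set.mem_symmDiff]
        _ = ‖c‖ₑ * μ (internalSet u A ∆ s) :=
            lintegral_indicator_const ((hmeas A).symmDiff (hle _ hs)) _
        _ ≤ δ * ‖c‖ₑ := by rw [mul_comm]; gcongr
        _ ≤ η := hδ'.le
    · exact (integrable_const c).indicator (hmeas A)
    · exact hm1.aestronglyMeasurable
    · refine ⟨fun k => (A k).indicator fun _ => c, fun k x y hxy => ?_, fun S => ?_⟩
      · have := hA k hxy
        by_cases h : x ∈ A k
        · simp [h, this.1 h]
        · simp [h, mt this.2 h]
      · rw [setIntegral_indicator (hmeas A), internalSet_inter]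
        simp_rw [fun k => setIntegral_indicator (μ := uniformOn (Set.univ : Set (α → V k)))
          (f := fun _ => c) (s := S k) (MeasurableSet.of_discrete (s := A k)), setIntegral_const]
        refine Tendsto.smul_const ?_ c
        exact (ENNReal.tendsto_toReal (measure_ne_top _ _)).comp (hμ _)
  have h1P : ∀ g g', P g → P g' → P (g + g') := by
    rintro g g' ⟨hi, hm, G, hG, hl⟩ ⟨hi', hm', G', hG', hl'⟩
    refine ⟨hi.add hi', hm.add hm', fun k x => G k x + G' k x, fun k x y hxy => ?_, fun S => ?_⟩
    · simp only [hG k x y hxy, hG' k x y hxy]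
    · simp only [Pi.add_apply]
      rw [integral_add hi.integrableOn hi'.integrableOn]
      refine ((hl S).add (hl' S)).congr fun k => ?_
      exact (integral_add Integrable.of_finite Integrable.of_finite).symm
  obtain ⟨g, hg, hgint, hgm, G, hG, hlim⟩ := @MemLp.induction_dense _ _ (cylinderSigma u V f) _ 1
    (μ.trim hle) ENNReal.one_ne_top P h0P h1P (fun g hg => hg.2.1) _ hMemLp (ENNReal.ofReal ε)
    (by simpa using hε)
  refine ⟨g, G, hG, hlim, fun S => ?_⟩
  rw [eLpNorm_trim_ae hle (hg₀.aestronglyMeasurable.sub hgm), eLpNorm_one_eq_lintegral_enorm,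
    ← ofReal_integral_norm_eq_lintegral_enorm (hint.sub hgint),
    ENNReal.ofReal_le_ofReal_iff hε.le] at hg
  rw [← integral_sub hint.integrableOn hgint.integrableOn]
  refine (abs_integral_le_integral_abs).trans (le_trans ?_ hg)
  exact setIntegral_le_integral (hint.sub hgint).norm (ae_of_all _ fun x => abs_nonneg _)

variable [DecidableEq α] [∀ k, Nonempty (V k)]

/-- A function of the coordinates in `f` orthogonal to the sets of size less than `l` inside `f`
is orthogonal to all sets meeting `f` in fewer than `l` elements. -/
lemma setIntegral_eq_zero_of_lowerSigma {f : Finset α} {l : ℕ} (hle : cylinderSigma u V f ≤ m)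
    (hm : MeasurableSpace.generateFrom (Set.range (internalSet u)) ≤ m)
    (hμ : ∀ A : ∀ k, Set (α → V k),
      Tendsto (fun k => uniformOn Set.univ (A k)) u (𝓝 (μ (internalSet u A))))
    {g₀ : (∀ k, α → V k) → ℝ} (hg₀ : StronglyMeasurable[cylinderSigma u V f] g₀)
    (hint : Integrable g₀ μ)
    (h0 : ∀ T, MeasurableSet[lowerSigma (cylinderSigma u V) f l] T → ∫ x in T, g₀ x ∂μ = 0)
    {s : Set (∀ k, α → V k)}
    (hs : s ∈ piiUnionInter (internalCylinders u V) {e | (e ∩ f).card < l}) :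
    ∫ x in s, g₀ x ∂μ = 0 := by
  obtain ⟨t, ht, A', hA', rfl⟩ := hs
  have hA'' : ∀ e, ∃ A : ∀ k, Set (α → V k), e ∈ t → (∀ k, IsCylinder e (A k)) ∧
      internalSet u A = A' e := by
    intro e
    by_cases he : e ∈ t
    · obtain ⟨A, hA⟩ := hA' e he
      exact ⟨A, fun _ => hA⟩
    · exact ⟨fun _ => ∅, fun h => absurd h he⟩
  choose A hA using hA''
  have hS : ⋂ e ∈ t, A' e = internalSet u (fun k => ⋂ e ∈ t, A e k) := by
    rw [Set.iInter₂_congr fun e he => (hA e he).2.symm]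
    exact (internalSet_biInter t A).symm
  rw [hS]
  refine abs_nonpos_iff.1 (le_of_forall_pos_le_add fun ε hε => ?_)
  obtain ⟨g, G, hG, hlim, happ⟩ := exists_setIntegral_approx hle hm hμ hg₀ hint (half_pos hε)
  choose y hy using fun k => exists_abs_setIntegral_uniformOn_le f (hG k) (⋂ e ∈ t, A e k)
  have hT : MeasurableSet[lowerSigma (cylinderSigma u V) f l]
      (internalSet u fun k => {x | f.piecewise x (y k) ∈ ⋂ e ∈ t, A e k}) := by
    have h1 : (internalSet u fun k => {x | f.piecewise x (y k) ∈ ⋂ e ∈ t, A e k}) =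
        ⋂ e ∈ t, internalSet u fun k => {x | f.piecewise x (y k) ∈ A e k} := by
      rw [← internalSet_biInter t fun e k => {x | f.piecewise x (y k) ∈ A e k}]
      congr 1
      ext k x
      simp
    rw [h1]
    refine Finset.measurableSet_biInter _ fun e he => ?_
    refine le_lowerSigma (e := e ∩ f) inter_subset_right (ht he) _ ?_
    exact MeasurableSpace.measurableSet_generateFrom
      ⟨_, fun k => ((hA e he).1 k).preimage_piecewise f (y k), rfl⟩
  have h1 := le_of_tendsto_of_tendsto' (hlim _).abs
    (hlim fun k => {x | f.piecewise x (y k) ∈ ⋂ e ∈ t, A e k}).abs hy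
  have h2 := happ (internalSet u fun k => ⋂ e ∈ t, A e k)
  have h3 := happ (internalSet u fun k => {x | f.piecewise x (y k) ∈ ⋂ e ∈ t, A e k})
  rw [h0 _ hT] at h3
  rw [abs_le] at *
  constructor <;> cases abs_cases (∫ x in internalSet u fun k =>
    {x | f.piecewise x (y k) ∈ ⋂ e ∈ t, A e k}, g x ∂μ) <;> linarith

theorem exists_isCondProb_cylinderSigma (hle : ∀ e, cylinderSigma u V e ≤ m)
    (hm : MeasurableSpace.generateFrom (Set.range (internalSet u)) ≤ m)
    (hμ : ∀ A : ∀ k, Set (α → V k),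
      Tendsto (fun k => uniformOn Set.univ (A k)) u (𝓝 (μ (internalSet u A))))
    (f : Finset α) (l : ℕ) {U : Set (∀ k, α → V k)} (hU : MeasurableSet[cylinderSigma u V f] U) :
    ∃ p, IsCondProb (cylinderSigma u V) μ f l U p := by
  have hlow : lowerSigma (cylinderSigma u V) f l ≤ m :=
    (lowerSigma_le cylinderSigma_mono f l).trans (hle f)
  have hcross : crossSigma (cylinderSigma u V) f l ≤ m := iSup₂_le fun e _ => hle e
  have hUm : MeasurableSet U := hle f _ hU
  have hUint : Integrable (U.indicator (fun _ => (1 : ℝ))) μ := (integrable_const 1).indicator hUm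
  set c : (∀ k, α → V k) → ℝ :=
    μ[U.indicator (fun _ => (1 : ℝ)) | lowerSigma (cylinderSigma u V) f l] with hc
  have hcm : StronglyMeasurable[lowerSigma (cylinderSigma u V) f l] c := stronglyMeasurable_condExp
  have hcint : Integrable c μ := integrable_condExp
  have hcnn : 0 ≤ᵐ[μ] c := condExp_nonneg (ae_of_all _ fun x =>
    Set.indicator_nonneg (fun _ _ => zero_le_one) x)
  have hpm : Measurable[lowerSigma (cylinderSigma u V) f l] fun x => ENNReal.ofReal (c x) :=
    hcm.measurable.ennreal_ofReal
  have hpm' : Measurable fun x => ENNReal.ofReal (c x) := hpm.mono hlow le_rfl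
  have hg₀ : StronglyMeasurable[cylinderSigma u V f] (U.indicator (fun _ => (1 : ℝ)) - c) :=
    (stronglyMeasurable_const.indicator hU).sub
      (hcm.mono (lowerSigma_le cylinderSigma_mono f l))
  have h0 : ∀ T, MeasurableSet[lowerSigma (cylinderSigma u V) f l] T →
      ∫ x in T, (U.indicator (fun _ => (1 : ℝ)) - c) x ∂μ = 0 := by
    intro T hT
    simp only [Pi.sub_apply]
    rw [integral_sub hUint.integrableOn hcint.integrableOn, setIntegral_condExp hlow hUint hT,
      sub_self]
  have hset : ∀ s ∈ piiUnionInter (internalCylinders u V) {e | (e ∩ f).card < l},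
      μ (s ∩ U) = ∫⁻ x in s, ENNReal.ofReal (c x) ∂μ := by
    intro s hs
    have h1 := setIntegral_eq_zero_of_lowerSigma (hle f) hm hμ hg₀ (hUint.sub hcint) h0 hs
    simp only [Pi.sub_apply] at h1
    rw [integral_sub hUint.integrableOn hcint.integrableOn, sub_eq_zero,
      setIntegral_indicator hUm, setIntegral_const, smul_eq_mul, mul_one] at h1
    rw [← ofReal_integral_eq_lintegral_ofReal hcint.integrableOn (ae_restrict_of_ae hcnn), ← h1,
      ofReal_measureReal]
  have hgen : crossSigma (cylinderSigma u V) f l = MeasurableSpace.generateFrom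
      (piiUnionInter (internalCylinders u V) {e | (e ∩ f).card < l}) := by
    refine le_antisymm (iSup₂_le fun e he => MeasurableSpace.generateFrom_mono
      (subset_piiUnionInter he)) (MeasurableSpace.generateFrom_le ?_)
    rintro _ ⟨t, ht, A, hA, rfl⟩
    exact Finset.measurableSet_biInter _ fun e he => le_crossSigma (ht he) _
      (MeasurableSpace.measurableSet_generateFrom (hA e he))
  have hsm : ∀ s ∈ piiUnionInter (internalCylinders u V) {e | (e ∩ f).card < l},
      MeasurableSet[crossSigma (cylinderSigma u V) f l] s := fun s hs => by
    rw [hgen]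
    exact MeasurableSpace.measurableSet_generateFrom hs
  have huniv : Set.univ ∈ piiUnionInter (internalCylinders u V) {e | (e ∩ f).card < l} :=
    ⟨∅, by simp, fun _ => ∅, by simp, by simp⟩
  have hEq : ∀ s ∈ piiUnionInter (internalCylinders u V) {e | (e ∩ f).card < l},
      (μ.restrict U).trim hcross s =
        (μ.withDensity fun x => ENNReal.ofReal (c x)).trim hcross s := by
    intro s hs
    have hs' := hsm s hs
    rw [trim_measurableSet_eq hcross hs', trim_measurableSet_eq hcross hs',
      Measure.restrict_apply (hcross _ hs'), withDensity_apply _ (hcross _ hs'), hset s hs]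
  have hpi := isPiSystem_piiUnionInter (internalCylinders u V)
    (fun e => (isSetAlgebra_internalCylinders e).isSetRing.isSetSemiring.isPiSystem)
    {e | (e ∩ f).card < l}
  have hmeas : (μ.restrict U).trim hcross =
      (μ.withDensity fun x => ENNReal.ofReal (c x)).trim hcross :=
    @ext_of_generate_finite _ (crossSigma (cylinderSigma u V) f l) _ _ _ hgen hpi inferInstance
      hEq (hEq _ huniv)
  refine ⟨fun x => ENNReal.ofReal (c x), hpm, fun h hh => ?_⟩
  have hh' : Measurable h := hh.mono hcross le_rfl
  calc ∫⁻ x, U.indicator 1 x * h x ∂μ = ∫⁻ x in U, h x ∂μ := by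
        rw [← lintegral_indicator hUm]
        refine lintegral_congr fun x => ?_
        by_cases hx : x ∈ U <;> simp [hx]
    _ = ∫⁻ x, h x ∂(μ.withDensity fun x => ENNReal.ofReal (c x)) := by
        rw [← lintegral_trim hcross hh, hmeas, lintegral_trim hcross hh]
    _ = ∫⁻ x, ENNReal.ofReal (c x) * h x ∂μ :=
        lintegral_withDensity_eq_lintegral_mul _ hpm' hh'

end CondProb

/-- If a measure on `α → Fin n`, bounded by a multiple of the uniform measure on cylinders over
the sets of `F`, is carried by each of a family of such cylinders, then a positive proportion of
the functions lie in all of these cylinders. -/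
theorem exists_le_uniformOn_biInter [Fintype α] [DecidableEq α] {F : Finset (Finset α)}
    (hF : F.Nonempty) {C c : ℝ≥0∞} (hC : C ≠ ⊤) (hc : c ≠ 0) :
    ∃ δ : ℝ≥0∞, 0 < δ ∧ ∀ (n : ℕ) [NeZero n] (ν : Measure (α → Fin n)), c ≤ ν Set.univ →
      (∀ f ∈ F, ∀ A, IsCylinder f A → ν A ≤ C * uniformOn Set.univ A) →
      ∀ A : Finset α → Set (α → Fin n), (∀ f ∈ F, IsCylinder f (A f)) →
        (∀ f ∈ F, ν (A f)ᶜ = 0) → δ ≤ uniformOn Set.univ (⋂ f ∈ F, A f) := by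
  by_contra! hcon
  choose n hn ν hcν hνμ A hA hνA hlt using fun j : ℕ =>
    hcon ((j : ℝ≥0∞) + 1)⁻¹ (by simp)
  let u : Ultrafilter ℕ := hyperfilter ℕ
  have hu : (u : Filter ℕ) ≤ atTop := Nat.hyperfilter_le_atTop
  let m : MeasurableSpace (∀ j, α → Fin (n j)) :=
    MeasurableSpace.generateFrom (Set.range (internalSet u))
  obtain ⟨μ, hμ⟩ := exists_loeb_measure hu rfl fun j => uniformOn (Set.univ : Set (α → Fin (n j)))
  obtain ⟨ν', hν'⟩ := exists_loeb_measure hu rfl ν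
  have hle : ∀ e, cylinderSigma u (fun j => Fin (n j)) e ≤ m := fun e => cylinderSigma_le e
  have hμ1 : IsProbabilityMeasure μ := by
    refine ⟨tendsto_nhds_unique (internalSet_univ (u := u) ▸ hμ fun j => Set.univ) ?_⟩
    have : ∀ j, uniformOn (Set.univ : Set (α → Fin (n j))) Set.univ = 1 := fun j =>
      uniformOn_self Set.finite_univ Set.univ_nonempty
    simp only [this]
    exact tendsto_const_nhds
  have hcyl : ∀ f ∈ F, ∀ A : ∀ j, Set (α → Fin (n j)), (∀ j, IsCylinder f (A j)) →
      ν' (internalSet u A) ≤ C * μ (internalSet u A) := fun f hf A hA =>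
    le_of_tendsto_of_tendsto' (hν' A) (ENNReal.Tendsto.const_mul (hμ A) (Or.inr hC))
      fun j => hνμ j f hf _ (hA j)
  have hνfin : IsFiniteMeasure ν' := by
    obtain ⟨f, hf⟩ := hF
    have h := hcyl f hf (fun j => Set.univ) fun j x y _ => Iff.rfl
    rw [internalSet_univ, measure_univ (μ := μ), mul_one] at h
    exact ⟨h.trans_lt hC.lt_top⟩
  have hν0 : ν' Set.univ ≠ 0 := by
    have h := ge_of_tendsto' (hν' fun j => Set.univ) hcν
    rw [internalSet_univ] at h
    exact (lt_of_lt_of_le (pos_iff_ne_zero.2 hc) h).ne'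
  have hpos := measure_biInter_pos_of_carrier (μ := μ) hle cylinderSigma_mono
    (fun f l U hU => exists_isCondProb_cylinderSigma hle le_rfl hμ f l hU) F hC
    (F.sup card + 1) ν' hν0
    (fun f hf U hU => measure_le_of_internalCylinders (hle f) hC (hcyl f hf) hU)
    (A := fun f => internalSet u fun j => A j f)
    (fun f hf => le_lowerSigma (Subset.refl f) (Nat.lt_succ_of_le (Finset.le_sup hf)) _
      (MeasurableSpace.measurableSet_generateFrom ⟨_, fun j => hA j f hf, rfl⟩))
    (fun f hf => by
      rw [internalSet_compl]
      refine tendsto_nhds_unique (hν' _) ?_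
      simp only [fun j => hνA j f hf]
      exact tendsto_const_nhds)
  rw [← internalSet_biInter F fun f j => A j f] at hpos
  refine hpos.ne' (le_antisymm ?_ zero_le)
  refine le_of_tendsto_of_tendsto' (hμ _) ?_ fun j => (hlt j).le
  refine Tendsto.mono_left ?_ hu
  exact_mod_cast (tendsto_add_atTop_iff_nat (f := fun j : ℕ => (j : ℝ≥0∞)⁻¹) 1).2
    ENNReal.tendsto_inv_nat_nhds_zero

end CylinderSigma

section BergeCounting

open MeasureTheory ProbabilityTheory ENNReal

variable {α : Type*} [DecidableEq α]

lemma containsBerge_of_forall_card_le {β : Type*} [DecidableEq β] {F : Finset (Finset α)}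
    {H : Finset (Finset β)} {x : α → β} (hx : Function.Injective x)
    (h : ∀ e ∈ F, #F ≤ #{g ∈ H | e.image x ⊆ g}) : ContainsBerge F H := by
  have hall : ∀ s : Finset F, #s ≤ #(s.biUnion fun e => {g ∈ H | e.1.image x ⊆ g}) := by
    intro s
    rcases s.eq_empty_or_nonempty with rfl | ⟨e, he⟩
    · simp
    · calc #s ≤ #F := by simpa using s.card_le_univ
        _ ≤ _ := h e.1 e.2
        _ ≤ _ := Finset.card_le_card (Finset.subset_biUnion_of_mem
            (fun e : F => {g ∈ H | e.1.image x ⊆ g}) he)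
  obtain ⟨f, hf, hft⟩ := (Finset.all_card_le_biUnion_card_iff_exists_injective _).1 hall
  simp only [Finset.mem_filter] at hft
  refine ⟨x, fun e => if he : e ∈ F then f ⟨e, he⟩ else ∅, hx, ?_, ?_, ?_⟩
  · intro e he e' he' hee
    rw [Finset.mem_coe] at he he'
    simp only [he, he', dif_pos] at hee
    exact congrArg Subtype.val (hf hee)
  · intro e he
    simp only [he, dif_pos]
    exact (hft ⟨e, he⟩).1
  · intro e he
    simp only [he, dif_pos]
    exact (hft ⟨e, he⟩).2

/-- In a Berge-`F`-free hypergraph, every `k` vertices span a copy of `F` all of whose edges lie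
in few hyperedges. -/
lemma exists_light_copy {β : Type*} [DecidableEq β] {r k : ℕ} {F : Finset (Finset α)}
    (hk : RamseyProp k r F) {H : Finset (Finset β)} (hH : ¬ ContainsBerge F H) {S : Finset β}
    (hS : k ≤ #S) :
    ∃ x : α → β, Function.Injective x ∧ (∀ a, x a ∈ S) ∧
      ∀ e ∈ F, #{g ∈ H | e.image x ⊆ g} < #F := by
  obtain ⟨S', hS', hcard⟩ := Finset.exists_subset_card_eq hS
  let ψ : Fin k → β := fun i => (S'.equivFinOfCardEq hcard).symm i
  have hψ : Function.Injective ψ :=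
    Subtype.val_injective.comp (S'.equivFinOfCardEq hcard).symm.injective
  obtain ⟨c, φ, hφ, hc⟩ := hk fun e => decide (#{g ∈ H | e.image ψ ⊆ g} < #F)
  have hc' : ∀ e ∈ F, decide (#{g ∈ H | e.image (ψ ∘ φ) ⊆ g} < #F) = c := by
    intro e he
    rw [← Finset.image_image]
    exact (Finset.mem_filter.1 (hc e he)).2
  cases c with
  | false =>
    refine absurd (containsBerge_of_forall_card_le (hψ.comp hφ) fun e he => ?_) hH
    simpa using hc' e he
  | true =>
    exact ⟨ψ ∘ φ, hψ.comp hφ, fun a => hS' ((S'.equivFinOfCardEq hcard).symm (φ a)).2,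
      fun e he => by simpa using hc' e he⟩

lemma card_powersetCard_superset_le {β : Type*} [DecidableEq β] {p h : Finset β} {k : ℕ}
    (hp : p ⊆ h) : #{S ∈ h.powersetCard k | p ⊆ S} ≤ (#h - #p).choose (k - #p) := by
  rw [← Finset.card_sdiff_of_subset hp, ← Finset.card_powersetCard]
  refine Finset.card_le_card_of_injOn (· \ p) (fun S hS => ?_) fun S hS S' hS' hEq => ?_
  · simp only [Finset.coe_filter, Set.mem_ofPred_eq, Finset.mem_powersetCard] at hS
    simp only [Finset.mem_coe, Finset.mem_powersetCard]
    exact ⟨Finset.sdiff_subset_sdiff hS.1.1 le_rfl,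
      by rw [Finset.card_sdiff_of_subset hS.2, hS.1.2]⟩
  · simp only [Finset.coe_filter, Set.mem_ofPred_eq] at hS hS'
    rw [← Finset.sdiff_union_of_subset hS.2, ← Finset.sdiff_union_of_subset hS'.2]
    exact congrArg (· ∪ p) hEq

/-- If every `k`-subset of `h` contains an `r`-set of `P`, then `P` contains a positive proportion
of the `r`-subsets of `h`. -/
lemma choose_card_le_of_forall_exists {β : Type*} [DecidableEq β] {r k : ℕ} (hrk : r ≤ k)
    {h : Finset β} (hk : k ≤ #h) (P : Finset β → Prop) [DecidablePred P]
    (hP : ∀ S ⊆ h, #S = k → ∃ p ⊆ S, #p = r ∧ P p) :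
    (#h).choose r ≤ k.choose r * #{p ∈ h.powersetCard r | P p} := by
  have h1 : #(h.powersetCard k) ≤
      ∑ p ∈ h.powersetCard r with P p, #{S ∈ h.powersetCard k | p ⊆ S} := by
    refine (Finset.card_le_card ?_).trans Finset.card_biUnion_le
    intro S hS
    obtain ⟨hSh, hSk⟩ := Finset.mem_powersetCard.1 hS
    obtain ⟨p, hpS, hpr, hp⟩ := hP S hSh hSk
    simp only [Finset.mem_biUnion, Finset.mem_filter, Finset.mem_powersetCard]
    exact ⟨p, ⟨⟨hpS.trans hSh, hpr⟩, hp⟩, ⟨hSh, hSk⟩, hpS⟩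
  have h2 : ∑ p ∈ h.powersetCard r with P p, #{S ∈ h.powersetCard k | p ⊆ S} ≤
      #{p ∈ h.powersetCard r | P p} * (#h - r).choose (k - r) := by
    refine Finset.sum_le_card_nsmul _ _ _ fun p hp => ?_
    obtain ⟨hph, hpr⟩ := Finset.mem_powersetCard.1 (Finset.mem_filter.1 hp).1
    exact hpr ▸ card_powersetCard_superset_le hph
  rw [Finset.card_powersetCard] at h1
  have h3 : 0 < (#h - r).choose (k - r) := Nat.choose_pos (by omega)
  refine Nat.le_of_mul_le_mul_right ?_ h3
  calc (#h).choose r * (#h - r).choose (k - r) = (#h).choose k * k.choose r :=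
        (Nat.choose_mul hrk).symm
    _ ≤ (#{p ∈ h.powersetCard r | P p} * (#h - r).choose (k - r)) * k.choose r := by
        gcongr
        exact h1.trans h2
    _ = _ := by ring

lemma pow_le_mul_choose {m r : ℕ} (hr : 1 ≤ r) (hm : r ≤ m) :
    m ^ r ≤ r ^ r * r.factorial * m.choose r := by
  have h1 : m ≤ r * (m + 1 - r) := by
    obtain ⟨t, rfl⟩ := Nat.exists_eq_add_of_le hm
    have : r + t + 1 - r = t + 1 := by omega
    rw [this]
    nlinarith
  calc m ^ r ≤ (r * (m + 1 - r)) ^ r := Nat.pow_le_pow_left h1 r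
    _ = r ^ r * (m + 1 - r) ^ r := mul_pow _ _ _
    _ ≤ r ^ r * (r.factorial * m.choose r) := by
        gcongr
        rw [← Nat.descFactorial_eq_factorial_mul_choose]
        exact Nat.pow_sub_le_descFactorial m r
    _ = _ := by ring

/-- The sum of the `r`-th powers of the hyperedge sizes of a Berge-`F`-free hypergraph is
`O(n ^ r)`. -/
lemma sum_card_pow_le {r k n : ℕ} (hr : 1 ≤ r) (hrk : r ≤ k) {F : Finset (Finset α)}
    (hF : ∀ e ∈ F, #e = r) (hF0 : F.Nonempty) (hk : RamseyProp k r F)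
    {H : Finset (Finset (Fin n))} (hH : ¬ ContainsBerge F H) (hHk : ∀ h ∈ H, k ≤ #h) :
    ∑ h ∈ H, #h ^ r ≤ r ^ r * r.factorial * k.choose r * #F * n ^ r := by
  obtain ⟨e, he⟩ := hF0
  let P : Finset (Fin n) → Prop := fun p => #{g ∈ H | p ⊆ g} < #F
  have h1 : ∀ h ∈ H, (#h).choose r ≤ k.choose r * #{p ∈ h.powersetCard r | P p} := by
    intro h hh
    refine choose_card_le_of_forall_exists hrk (hHk h hh) P fun S _ hSk => ?_
    obtain ⟨x, hx, hxS, hxl⟩ := exists_light_copy hk hH hSk.ge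
    refine ⟨e.image x, fun i hi => ?_, ?_, hxl e he⟩
    · obtain ⟨a, _, rfl⟩ := Finset.mem_image.1 hi
      exact hxS a
    · rw [Finset.card_image_of_injective _ hx, hF e he]
  have h2 : ∑ h ∈ H, #{p ∈ h.powersetCard r | P p} ≤ #F * n ^ r := by
    have h3 : ∀ h ∈ H, #{p ∈ h.powersetCard r | P p} =
        ∑ p ∈ (Finset.univ : Finset (Fin n)).powersetCard r with P p, if p ⊆ h then 1 else 0 := by
      intro h _
      rw [← Finset.card_filter]
      congr 1
      ext p
      simp only [Finset.mem_filter, Finset.mem_powersetCard, Finset.subset_univ, true_and]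
      tauto
    rw [Finset.sum_congr rfl h3, Finset.sum_comm]
    calc ∑ p ∈ (Finset.univ : Finset (Fin n)).powersetCard r with P p,
          ∑ h ∈ H, (if p ⊆ h then 1 else 0)
        ≤ ∑ p ∈ (Finset.univ : Finset (Fin n)).powersetCard r with P p, #F := by
          refine Finset.sum_le_sum fun p hp => ?_
          rw [← Finset.card_filter]
          exact (Finset.mem_filter.1 hp).2.le
      _ ≤ #F * n ^ r := by
          rw [Finset.sum_const, smul_eq_mul, mul_comm]
          gcongr
          refine (Finset.card_filter_le _ _).trans ?_
          rw [Finset.card_powersetCard, Finset.card_univ, Fintype.card_fin]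
          exact Nat.choose_le_pow n r
  calc ∑ h ∈ H, #h ^ r
      ≤ ∑ h ∈ H, r ^ r * r.factorial * (k.choose r * #{p ∈ h.powersetCard r | P p}) := by
        refine Finset.sum_le_sum fun h hh => ?_
        refine (pow_le_mul_choose hr (hrk.trans (hHk h hh))).trans ?_
        gcongr
        exact h1 h hh
    _ = r ^ r * r.factorial * k.choose r * ∑ h ∈ H, #{p ∈ h.powersetCard r | P p} := by
        rw [Finset.mul_sum]
        exact Finset.sum_congr rfl fun _ _ => by ring
    _ ≤ r ^ r * r.factorial * k.choose r * (#F * n ^ r) := by gcongr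
    _ = _ := by ring

lemma card_filter_mem_le [Fintype α] {n M : ℕ} (v : α) (W : (α → Fin n) → Finset (Fin n))
    (hW : ∀ z a, W (Function.update z v a) = W z) (hM : ∀ z, #(W z) ≤ M) :
    n * #{z : α → Fin n | z v ∈ W z} ≤ M * n ^ Fintype.card α := by
  calc n * #{z : α → Fin n | z v ∈ W z}
      = #((univ : Finset (Fin n)) ×ˢ ({z : α → Fin n | z v ∈ W z} : Finset _)) := by simp
    _ ≤ #((univ : Finset (α → Fin n)).sigma W) := by
        refine card_le_card_of_injOn (fun p => ⟨Function.update p.2 v p.1, p.2 v⟩) ?_ ?_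
        · rintro ⟨a, z⟩ h
          simp only [coe_product, Set.mem_prod, mem_coe, mem_filter, mem_univ, true_and] at h
          simpa [hW] using h
        · rintro ⟨a, z⟩ - ⟨b, y⟩ - h
          simp only [Sigma.mk.injEq, heq_eq_eq] at h
          obtain ⟨h1, h2⟩ := h
          have hab : a = b := by simpa using congrFun h1 v
          refine Prod.ext hab (funext fun i => ?_)
          by_cases hi : i = v
          · rw [hi]
            exact h2
          · simpa [hi] using congrFun h1 i
    _ = ∑ z : α → Fin n, #(W z) := card_sigma _ _
    _ ≤ ∑ _z : α → Fin n, M := sum_le_sum fun z _ => hM z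
    _ = M * n ^ Fintype.card α := by simp [mul_comm]

lemma card_filter_forall_eq_mul_pow [Fintype α] {n : ℕ} (f : Finset α) (x : α → Fin n) :
    #{z : α → Fin n | ∀ i ∈ f, x i = z i} * n ^ #f = n ^ Fintype.card α := by
  have h : ({z : α → Fin n | ∀ i ∈ f, x i = z i} : Finset (α → Fin n)) =
      Fintype.piFinset fun i => if i ∈ f then {x i} else univ := by
    ext z
    simp only [mem_filter, mem_univ, true_and, Fintype.mem_piFinset]
    refine forall_congr' fun i => ?_
    by_cases hi : i ∈ f <;> simp [hi, eq_comm]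
  rw [h, Fintype.card_piFinset]
  have h2 : ∀ i, #(if i ∈ f then {x i} else (univ : Finset (Fin n))) =
      if i ∈ f then 1 else n := by
    intro i
    split_ifs <;> simp
  simp only [h2]
  rw [prod_ite]
  simp only [prod_const_one, one_mul, prod_const]
  rw [← pow_add, add_comm, filter_not, filter_mem_eq_inter, univ_inter,
    card_sdiff_of_subset (subset_univ f), card_univ,
    Nat.add_sub_cancel' (card_le_univ f)]

lemma card_filter_mem_cylinder_mul_le [Fintype α] {ι : Type*} {n L : ℕ} {f : Finset α}
    (T : Finset ι) (x : ι → α → Fin n)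
    (hL : ∀ z : α → Fin n, #{h ∈ T | ∀ i ∈ f, x h i = z i} ≤ L) {A : Set (α → Fin n)}
    [DecidablePred (· ∈ A)] (hA : IsCylinder f A) :
    #{h ∈ T | x h ∈ A} * n ^ Fintype.card α ≤ L * n ^ #f * #{z | z ∈ A} := by
  have h1 : ∑ h ∈ T with x h ∈ A, #{z : α → Fin n | ∀ i ∈ f, x h i = z i} ≤
      L * #{z | z ∈ A} := by
    calc ∑ h ∈ T with x h ∈ A, #{z : α → Fin n | ∀ i ∈ f, x h i = z i}
        ≤ ∑ h ∈ T, #{z ∈ ({z | z ∈ A} : Finset _) | ∀ i ∈ f, x h i = z i} := by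
          rw [sum_filter]
          refine sum_le_sum fun h _ => ?_
          split_ifs with hx
          · refine card_le_card fun z hz => ?_
            simp only [mem_filter, mem_univ, true_and] at hz ⊢
            exact ⟨(hA hz).1 hx, hz⟩
          · exact zero_le
      _ = ∑ z with z ∈ A, #{h ∈ T | ∀ i ∈ f, x h i = z i} :=
          sum_card_bipartiteAbove_eq_sum_card_bipartiteBelow
            (fun (h : ι) (z : α → Fin n) => ∀ i ∈ f, x h i = z i)
      _ ≤ #{z | z ∈ A} * L := sum_le_card_nsmul _ _ _ fun z _ => hL z
      _ = _ := mul_comm _ _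
  calc #{h ∈ T | x h ∈ A} * n ^ Fintype.card α
      = (∑ h ∈ T with x h ∈ A, #{z : α → Fin n | ∀ i ∈ f, x h i = z i}) * n ^ #f := by
        rw [sum_mul, sum_congr rfl fun h _ => card_filter_forall_eq_mul_pow f (x h), sum_const,
          smul_eq_mul]
    _ ≤ (L * #{z | z ∈ A}) * n ^ #f := by gcongr
    _ = _ := by ring

lemma exists_le_card_filter_forall_exists [Fintype α] {r : ℕ} {F : Finset (Finset α)}
    (hF : F.Nonempty) (hFr : ∀ f ∈ F, #f = r) (L : ℕ) {c : ℝ} (hc : 0 < c) :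
    ∃ δ : ℝ, 0 < δ ∧ ∀ (n : ℕ) [NeZero n] {ι : Type*} (T : Finset ι)
      (x : ι → α → Fin n),
      (∀ f ∈ F, ∀ z : α → Fin n, #{h ∈ T | ∀ i ∈ f, x h i = z i} ≤ L) → c * n ^ r ≤ #T →
      δ * n ^ Fintype.card α ≤
        #{z : α → Fin n | ∀ f ∈ F, ∃ h ∈ T, ∀ i ∈ f, x h i = z i} := by
  classical
  obtain ⟨δ, hδ, h⟩ := exists_le_uniformOn_biInter hF (C := L) (c := .ofReal c)
    (natCast_ne_top L) (by simpa using hc)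
  refine ⟨(min δ 1).toReal, toReal_pos (by simp [hδ.ne']) (by simp), ?_⟩
  intro n _ ι T x hL hcT
  have hn : (n : ℝ≥0∞) ≠ 0 := Nat.cast_ne_zero.2 (NeZero.ne n)
  have hnr : (n : ℝ≥0∞) ^ r ≠ 0 := pow_ne_zero _ hn
  have hnr' : (n : ℝ≥0∞) ^ r ≠ ⊤ := pow_ne_top (natCast_ne_top n)
  have hna : (n : ℝ≥0∞) ^ Fintype.card α ≠ 0 := pow_ne_zero _ hn
  have hna' : (n : ℝ≥0∞) ^ Fintype.card α ≠ ⊤ := pow_ne_top (natCast_ne_top n)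
  let ν : Measure (α → Fin n) := ∑ h ∈ T, ((n : ℝ≥0∞) ^ r)⁻¹ • Measure.dirac (x h)
  have hν : ∀ (A : Set (α → Fin n)) [DecidablePred (· ∈ A)],
      ν A = #{h ∈ T | x h ∈ A} / (n : ℝ≥0∞) ^ r := by
    intro A _
    simp only [ν, Measure.finsetSum_apply, Measure.smul_apply, smul_eq_mul,
      Measure.dirac_apply' _ A.toFinite.measurableSet, ← mul_sum, Set.indicator_apply,
      Pi.one_apply, sum_boole]
    rw [div_eq_mul_inv, mul_comm]
  have hunif : ∀ A : Set (α → Fin n),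
      uniformOn Set.univ A = #{z | z ∈ A} / (n : ℝ≥0∞) ^ Fintype.card α := by
    intro A
    have h1 := Measure.count_apply_finset ({z | z ∈ A} : Finset (α → Fin n))
    rw [coe_filter_univ] at h1
    rw [uniformOn_univ, ← h1]
    simp
  have hmain := h n ν ?_ ?_ (fun f => {z | ∃ h ∈ T, ∀ i ∈ f, x h i = z i}) ?_ ?_
  · have hA : (⋂ f ∈ F, {z : α → Fin n | ∃ h ∈ T, ∀ i ∈ f, x h i = z i}) =
        {z | ∀ f ∈ F, ∃ h ∈ T, ∀ i ∈ f, x h i = z i} := by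
      ext z
      simp
    rw [hA, hunif, ENNReal.le_div_iff_mul_le (.inl hna) (.inl hna')] at hmain
    have h2 := toReal_mono (natCast_ne_top _) ((mul_le_mul_left (min_le_left δ 1) _).trans hmain)
    simpa using h2
  · rw [hν, ENNReal.le_div_iff_mul_le (.inl hnr) (.inl hnr')]
    have h2 := ofReal_le_ofReal hcT
    rw [ofReal_mul hc.le] at h2
    simpa using h2
  · intro f hf A hA
    have h2 := card_filter_mem_cylinder_mul_le T x (hL f hf) hA
    rw [hFr f hf] at h2
    have h3 : (L : ℝ≥0∞) * (#{z | z ∈ A} / (n : ℝ≥0∞) ^ Fintype.card α) * (n : ℝ≥0∞) ^ r =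
        L * (n : ℝ≥0∞) ^ r * #{z | z ∈ A} / (n : ℝ≥0∞) ^ Fintype.card α := by
      simp only [div_eq_mul_inv]
      ring
    rw [hν, hunif, ENNReal.div_le_iff hnr hnr', h3,
      ENNReal.le_div_iff_mul_le (.inl hna) (.inl hna')]
    exact_mod_cast h2
  · intro f hf y z hyz
    refine exists_congr fun h => and_congr_right fun _ => forall₂_congr fun i hi => ?_
    rw [hyz i hi]
  · intro f hf
    rw [hν, ENNReal.div_eq_zero_iff, Nat.cast_eq_zero, card_eq_zero]
    refine .inl (eq_empty_of_forall_notMem fun h hh => ?_)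
    exact (mem_filter.1 hh).2 ⟨h, (mem_filter.1 hh).1, fun _ _ => rfl⟩

/-- Berge-`F`-free hypergraphs with bounded hyperedge sizes, all at least `k`, have `o(n ^ r)`
hyperedges. -/
lemma exists_forall_card_le_mul_pow [Fintype α] {r k : ℕ} {F : Finset (Finset α)}
    (hF0 : F.Nonempty) (hF : ∀ e ∈ F, #e = r) (hk : RamseyProp k r F) (K : ℕ) {c : ℝ}
    (hc : 0 < c) :
    ∃ N : ℕ, ∀ n ≥ N, ∀ H : Finset (Finset (Fin n)), ¬ ContainsBerge F H →
      (∀ h ∈ H, k ≤ #h) → (∀ h ∈ H, #h ≤ K) → #H ≤ c * n ^ r := by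
  obtain ⟨δ, hδ, hZ⟩ := exists_le_card_filter_forall_exists hF0 hF #F hc
  set B : ℕ := Fintype.card α * Fintype.card α + #F * Fintype.card α * (#F * K) with hB
  obtain ⟨N, hN⟩ := exists_nat_gt (B / δ)
  refine ⟨N + 1, fun n hn H hH hHk hHK => ?_⟩
  by_contra! hcard
  have : NeZero n := ⟨by omega⟩
  have hx : ∀ h ∈ H, ∃ x : α → Fin n, (∀ a, x a ∈ h) ∧
      ∀ e ∈ F, #{g ∈ H | e.image x ⊆ g} < #F := fun h hh => by
    obtain ⟨x, -, hx⟩ := exists_light_copy hk hH (hHk h hh)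
    exact ⟨x, hx⟩
  choose! x hxh hxl using hx
  have hsub : ∀ (e : Finset α) (z : α → Fin n), ∀ h ∈ H, (∀ i ∈ e, x h i = z i) →
      e.image z ⊆ h := by
    intro e z h hh hz y hy
    obtain ⟨i, hi, rfl⟩ := mem_image.1 hy
    exact hz i hi ▸ hxh h hh i
  have hL : ∀ e ∈ F, ∀ z : α → Fin n, #{h ∈ H | ∀ i ∈ e, x h i = z i} ≤ #F := by
    intro e he z
    rcases ({h ∈ H | ∀ i ∈ e, x h i = z i} : Finset _).eq_empty_or_nonempty with h0 | ⟨h, hh⟩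
    · simp [h0]
    · obtain ⟨hh, hz⟩ := mem_filter.1 hh
      refine (card_le_card fun g hg => ?_).trans (hxl h hh e he).le
      rw [mem_filter] at hg ⊢
      rw [image_congr fun i hi => hz i hi]
      exact ⟨hg.1, hsub e z g hg.1 hg.2⟩
  let W : Finset α → (α → Fin n) → Finset (Fin n) := fun e z =>
    ({h ∈ H | ∀ i ∈ e, x h i = z i} : Finset _).biUnion id
  have hW : ∀ e ∈ F, ∀ z, #(W e z) ≤ #F * K := by
    intro e he z
    refine (card_biUnion_le_card_mul _ _ K fun h hh => hHK h (mem_filter.1 hh).1).trans ?_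
    gcongr
    exact hL e he z
  let Z : Finset (α → Fin n) := {z | ∀ f ∈ F, ∃ h ∈ H, ∀ i ∈ f, x h i = z i}
  have hcover : Z ⊆ ((univ : Finset (α × α)).filter fun p => p.1 ≠ p.2).biUnion
        (fun p => ({z | z p.1 ∈ ({z p.2} : Finset (Fin n))} : Finset (α → Fin n))) ∪
      ((F ×ˢ (univ : Finset α)).filter fun p => p.2 ∉ p.1).biUnion
        (fun p => ({z | z p.2 ∈ W p.1 z} : Finset (α → Fin n))) := by
    intro z hz
    simp only [mem_union, mem_biUnion, mem_filter, mem_univ, true_and, and_true, mem_product,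
      mem_singleton, Prod.exists]
    by_cases hinj : Function.Injective z
    · right
      have hz' := (mem_filter.1 hz).2
      choose! g hgH hgz using hz'
      by_cases hg : Set.InjOn g F
      · exact absurd ⟨z, g, hinj, hg, hgH, fun e he => hsub e z _ (hgH e he) (hgz e he)⟩ hH
      · simp only [Set.InjOn, not_forall] at hg
        obtain ⟨e, he, e', he', hee, hne⟩ := hg
        rw [mem_coe] at he he'
        have hns : ¬ e' ⊆ e := fun hs =>
          hne (eq_of_subset_of_card_le hs (by rw [hF e he, hF e' he'])).symm
        obtain ⟨v, hv', hv⟩ := not_subset.1 hns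
        refine ⟨e, v, ⟨he, hv⟩, mem_biUnion.2 ⟨g e, mem_filter.2 ⟨hgH e he, hgz e he⟩, ?_⟩⟩
        rw [id, hee, ← hgz e' he' v hv']
        exact hxh _ (hgH e' he') v
    · left
      simp only [Function.Injective, not_forall] at hinj
      obtain ⟨v, w, hvw, hne⟩ := hinj
      exact ⟨v, w, hne, hvw⟩
  have h1 : n * #Z ≤ B * n ^ Fintype.card α := by
    calc n * #Z
        ≤ n * (∑ p : α × α with p.1 ≠ p.2, #{z : α → Fin n | z p.1 ∈ ({z p.2} : Finset (Fin n))} +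
            ∑ p ∈ F ×ˢ univ with p.2 ∉ p.1, #{z : α → Fin n | z p.2 ∈ W p.1 z}) := by
          gcongr
          refine (card_le_card hcover).trans ((card_union_le _ _).trans ?_)
          exact add_le_add card_biUnion_le card_biUnion_le
      _ ≤ Fintype.card α * Fintype.card α * n ^ Fintype.card α +
            #F * Fintype.card α * (#F * K * n ^ Fintype.card α) := by
          rw [mul_add, mul_sum, mul_sum]
          refine add_le_add
            ((sum_le_card_nsmul _ _ (1 * n ^ Fintype.card α) fun p hp => ?_).trans ?_)
            ((sum_le_card_nsmul _ _ (#F * K * n ^ Fintype.card α) fun p hp => ?_).trans ?_)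
          · refine card_filter_mem_le _ (fun z => {z p.2}) (fun z a => ?_) fun z => by simp
            rw [Function.update_of_ne (mem_filter.1 hp).2.symm]
          · rw [smul_eq_mul, one_mul]
            gcongr
            exact (card_filter_le _ _).trans (by simp)
          · obtain ⟨hp, hp'⟩ := mem_filter.1 hp
            refine card_filter_mem_le _ (W p.1) (fun z a => ?_) (hW _ (mem_product.1 hp).1)
            refine congrArg (fun T : Finset (Finset (Fin n)) => T.biUnion id)
              (filter_congr fun h _ => forall₂_congr fun i hi => ?_)
            rw [Function.update_of_ne (ne_of_mem_of_not_mem hi hp')]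
          · rw [smul_eq_mul]
            gcongr
            exact (card_filter_le _ _).trans (by simp)
      _ = B * n ^ Fintype.card α := by
          rw [hB]
          ring
  have h2 := hZ n H x hL hcard.le
  have h3 : (n : ℝ) * #Z ≤ B * n ^ Fintype.card α := by exact_mod_cast h1
  have hn0 : (0 : ℝ) < n := Nat.cast_pos.2 (NeZero.pos n)
  have h4 : n * δ ≤ B := by
    refine le_of_mul_le_mul_right ?_ (pow_pos hn0 (Fintype.card α))
    refine le_trans ?_ h3
    rw [mul_assoc]
    gcongr
  rw [div_lt_iff₀ hδ] at hN
  have h5 : (N : ℝ) ≤ n := by exact_mod_cast (by omega : N ≤ n)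
  nlinarith

end BergeCounting

theorem statement2 {α : Type*} [DecidableEq α] (r k : ℕ) (hr : 2 ≤ r)
    (F : Finset (Finset α)) (hF : ∀ e ∈ F, e.card = r)
    (hk : RamseyProp k r F)
    (w : ℕ → ℕ)
    (hw : Filter.Tendsto (fun m : ℕ => (w m : ℝ) / (m : ℝ) ^ r) Filter.atTop (nhds 0)) :
    ∀ ε : ℝ, 0 < ε → ∃ N : ℕ, ∀ n ≥ N, ∀ H : Finset (Finset (Fin n)),
      ¬ ContainsBerge F H →
      (∀ h ∈ H, k ≤ h.card) →
      ∑ h ∈ H, (w h.card : ℝ) ≤ ε * (n : ℝ) ^ r := by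
  intro ε hε
  obtain ⟨b, ψ, hψ, hψF⟩ := hk fun _ => true
  have : Fintype α := @Fintype.ofFinite α (Finite.of_injective ψ hψ)
  rcases F.eq_empty_or_nonempty with rfl | hF0
  · refine ⟨k, fun n hn H hH _ => absurd ?_ hH⟩
    exact ⟨fun a => Fin.castLE hn (ψ a), fun _ => ∅, (Fin.castLE_injective hn).comp hψ,
      by simp, by simp, by simp⟩
  have hrk : r ≤ k := by
    obtain ⟨e, he⟩ := hF0
    calc r = #(e.image ψ) := by rw [card_image_of_injective _ hψ, hF e he]
      _ ≤ k := by simpa using card_le_univ (e.image ψ)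
  set C : ℝ := ((r ^ r * r.factorial * k.choose r * #F : ℕ) : ℝ) with hC
  have hC0 : 0 ≤ C := Nat.cast_nonneg _
  have hev : ∀ᶠ m : ℕ in Filter.atTop, (w m : ℝ) ≤ ε / (2 * (C + 1)) * (m : ℝ) ^ r := by
    filter_upwards [hw.eventually (gt_mem_nhds (by positivity : 0 < ε / (2 * (C + 1)))),
      Filter.eventually_gt_atTop 0] with m hm hm0
    have : (0 : ℝ) < (m : ℝ) ^ r := by positivity
    exact ((div_lt_iff₀ this).1 hm).le
  obtain ⟨K, hK⟩ := Filter.eventually_atTop.1 hev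
  set M : ℝ := ∑ m ∈ range K, (w m : ℝ) with hM
  have hM0 : 0 ≤ M := sum_nonneg fun _ _ => Nat.cast_nonneg _
  obtain ⟨N, hN⟩ := exists_forall_card_le_mul_pow hF0 hF hk K
    (by positivity : 0 < ε / (2 * (M + 1)))
  refine ⟨N, fun n hn H hH hHk => ?_⟩
  have hsub : ¬ ContainsBerge F {h ∈ H | #h < K} := fun ⟨φ, f, h1, h2, h3, h4⟩ =>
    hH ⟨φ, f, h1, h2, fun e he => (mem_filter.1 (h3 e he)).1, h4⟩
  have hsmall : ∑ h ∈ H with #h < K, (w #h : ℝ) ≤ ε / 2 * (n : ℝ) ^ r := by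
    calc ∑ h ∈ H with #h < K, (w #h : ℝ) ≤ #{h ∈ H | #h < K} • M :=
          sum_le_card_nsmul _ _ _ fun h hh =>
            single_le_sum (f := fun m => (w m : ℝ)) (fun _ _ => Nat.cast_nonneg _)
              (mem_range.2 (mem_filter.1 hh).2)
      _ ≤ (ε / (2 * (M + 1)) * (n : ℝ) ^ r) * (M + 1) := by
          rw [nsmul_eq_mul]
          gcongr
          · exact hN n hn _ hsub (fun h hh => hHk h (mem_filter.1 hh).1)
              fun h hh => (mem_filter.1 hh).2.le
          · linarith
      _ = ε / 2 * (n : ℝ) ^ r := by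
          field_simp
  have hlarge : ∑ h ∈ H with ¬ #h < K, (w #h : ℝ) ≤ ε / 2 * (n : ℝ) ^ r := by
    have hpow : ∑ h ∈ H, (#h : ℝ) ^ r ≤ C * (n : ℝ) ^ r := by
      rw [hC]
      exact_mod_cast sum_card_pow_le (by omega) hrk hF hF0 hk hH hHk
    calc ∑ h ∈ H with ¬ #h < K, (w #h : ℝ)
        ≤ ∑ h ∈ H with ¬ #h < K, ε / (2 * (C + 1)) * (#h : ℝ) ^ r :=
          sum_le_sum fun h hh => hK _ (not_lt.1 (mem_filter.1 hh).2)
      _ ≤ ∑ h ∈ H, ε / (2 * (C + 1)) * (#h : ℝ) ^ r :=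
          sum_le_sum_of_subset_of_nonneg (filter_subset _ _) fun _ _ _ => by positivity
      _ ≤ ε / (2 * (C + 1)) * ((C + 1) * (n : ℝ) ^ r) := by
          rw [← mul_sum]
          gcongr
          refine hpow.trans ?_
          gcongr
          linarith
      _ = ε / 2 * (n : ℝ) ^ r := by
          field_simp
  rw [← sum_filter_add_sum_filter_not H (#· < K)]
  linarith
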